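/- arXiv:2510.04004 — 8 statements merged into one kernel-verified Lean document; each statement's English description precedes it below -/
import Mathlib

section
/- Let (R, m) be a noetherian local ring and let k be a nonnegative integer. If the integral closure of J^{n+k} is contained in J^n for every m-primary ideal J and every integer n ≥ 1, then the integral closure of I^{n+k} is contained in I^n for every ideal I of R and every integer n ≥ 1. -/
/-- An element `r` is integral over the ideal `J` if it satisfies an equation
`r ^ m + a 1 * r ^ (m-1) + ⋯ + a m = 0` with `a i ∈ J ^ i`.  `Ideal.intClosure J` is the set of
all elements integral over `J`, i.e. the integral closure of `J`. -/
def Ideal.intClosure {R : Type*} [CommRing R] (J : Ideal R) : Set R :=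
  { r | ∃ m : ℕ, 0 < m ∧ ∃ a : ℕ → R, (∀ i, 1 ≤ i → i ≤ m → a i ∈ J ^ i) ∧
      r ^ m + ∑ i ∈ Finset.Icc 1 m, a i * r ^ (m - i) = 0 }

theorem Ideal.intClosure_mono {R : Type*} [CommRing R] {I J : Ideal R} (h : I ≤ J) :
    I.intClosure ⊆ J.intClosure := by
  rintro r ⟨m, hm, a, ha, hr⟩
  exact ⟨m, hm, a, fun i h₁ h₂ => Ideal.pow_right_mono h i (ha i h₁ h₂), hr⟩

theorem Ideal.sup_pow_le_pow_sup {R : Type*} [CommRing R] (I K : Ideal R) (n : ℕ) :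
    (I ⊔ K) ^ n ≤ I ^ n ⊔ K := by
  induction n with
  | zero => simp
  | succ n ih =>
    rw [pow_succ, pow_succ]
    refine (Ideal.mul_mono_left ih).trans ?_
    rw [Ideal.sup_mul, Ideal.mul_sup]
    have h₁ : I ^ n * K ≤ K := Ideal.mul_le_right
    have h₂ : K * (I ⊔ K) ≤ K := Ideal.mul_le_left
    exact sup_le (sup_le_sup_left h₁ _) (h₂.trans le_sup_right)

/-- **Krull's intersection theorem**: every ideal of a noetherian local ring is closed in the
topology defined by the maximal ideal. -/
theorem IsLocalRing.mem_of_forall_mem_sup_maximalIdeal_pow {R : Type*} [CommRing R]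
    [IsNoetherianRing R] [IsLocalRing R] {I : Ideal R} {r : R}
    (h : ∀ t : ℕ, r ∈ I ⊔ IsLocalRing.maximalIdeal R ^ t) : r ∈ I := by
  rw [← Ideal.Quotient.eq_zero_iff_mem, ← Submodule.mem_bot (R := R),
    ← Ideal.iInf_pow_smul_eq_bot_of_isLocalRing (M := R ⧸ I) (IsLocalRing.maximalIdeal R)
      (Ideal.IsPrime.ne_top inferInstance), Submodule.mem_iInf]
  intro t
  obtain ⟨a, ha, b, hb, rfl⟩ := Submodule.mem_sup.mp (h t)
  rw [map_add, Ideal.Quotient.eq_zero_iff_mem.mpr ha, zero_add, ← mul_one b, map_mul, map_one]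
  exact Submodule.smul_mem_smul hb (Submodule.mem_top (x := (1 : R ⧸ I)))

/-- **Reduction to `m`-primary ideals.**  Let `(R, m)` be a noetherian local ring and `k` a
nonnegative integer.  If `(J ^ (n + k))⁻ ⊆ J ^ n` for every `m`-primary ideal `J` and every
`n ≥ 1`, then `(I ^ (n + k))⁻ ⊆ I ^ n` for every ideal `I` and every `n ≥ 1`. -/
theorem intClosure_pow_le_of_forall_primary {R : Type*} [CommRing R] [IsNoetherianRing R]
    [IsLocalRing R] (k : ℕ)
    (H : ∀ J : Ideal R, (∃ t : ℕ, IsLocalRing.maximalIdeal R ^ t ≤ J) →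
      ∀ n : ℕ, 1 ≤ n → (J ^ (n + k)).intClosure ⊆ ↑(J ^ n)) :
    ∀ I : Ideal R, ∀ n : ℕ, 1 ≤ n → (I ^ (n + k)).intClosure ⊆ ↑(I ^ n) := by
  intro I n hn r hr
  refine IsLocalRing.mem_of_forall_mem_sup_maximalIdeal_pow fun t => ?_
  exact Ideal.sup_pow_le_pow_sup _ _ n <| H (I ⊔ IsLocalRing.maximalIdeal R ^ t)
    ⟨t, le_sup_right⟩ n hn (Ideal.intClosure_mono (Ideal.pow_right_mono le_sup_left _) hr)
end

section
/- Let R be a noetherian ring of prime characteristic p in which every element of R° is a non-zero-divisor (for example, R reduced). If I is an ideal of R that can be generated by ℓ elements, then for every integer n ≥ 1 the integral closure of I^{ℓ+n} is contained in the Frobenius closure (I^n)^F of I^n. -/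
/-- The bracket power `I ^ [q]`: the ideal generated by the `q`-th powers of elements of `I`. -/
def Ideal.frobPow {R : Type*} [CommRing R] (I : Ideal R) (q : ℕ) : Ideal R :=
  Ideal.span ((fun a => a ^ q) '' (I : Set R))

/-- The Frobenius closure of an ideal `I` in a ring of characteristic `p`:
`I^F = { r | r ^ (p ^ e) ∈ I ^ [p ^ e] for some e }`. -/
def Ideal.frobClosure {R : Type*} [CommRing R] (p : ℕ) (I : Ideal R) : Set R :=
  { r | ∃ e : ℕ, r ^ p ^ e ∈ I.frobPow (p ^ e) }

/-- If `r` satisfies an equation of integrality of degree `m` over `J`, then `r ^ N` lies in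
`J ^ (N + 1 - m)` for every `N`. -/
theorem Ideal.pow_mem_pow_of_integral_equation {R : Type*} [CommRing R] {J : Ideal R} {r : R}
    {m : ℕ} {a : ℕ → R} (ha : ∀ i, 1 ≤ i → i ≤ m → a i ∈ J ^ i)
    (h : r ^ m + ∑ i ∈ Finset.Icc 1 m, a i * r ^ (m - i) = 0) (N : ℕ) :
    r ^ N ∈ J ^ (N + 1 - m) := by
  induction N using Nat.strong_induction_on with
  | _ N ih =>
    rcases lt_or_ge N m with hN | hN
    · simp [Nat.sub_eq_zero_of_le (show N + 1 ≤ m from hN)]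
    · have hr : r ^ N = -∑ i ∈ Finset.Icc 1 m, a i * r ^ (N - i) := by
        have hsum : ∑ i ∈ Finset.Icc 1 m, a i * r ^ (N - i) =
            (∑ i ∈ Finset.Icc 1 m, a i * r ^ (m - i)) * r ^ (N - m) := by
          rw [Finset.sum_mul]
          refine Finset.sum_congr rfl fun i hi => ?_
          rw [Finset.mem_Icc] at hi
          rw [mul_assoc, ← pow_add]
          congr 2
          omega
        rw [hsum, eq_neg_of_add_eq_zero_right h, neg_mul, neg_neg,
          ← pow_add, Nat.add_sub_cancel' hN]
      rw [hr]
      refine neg_mem (Ideal.sum_mem _ fun i hi => ?_)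
      rw [Finset.mem_Icc] at hi
      have hmem := Ideal.mul_mem_mul (ha i hi.1 hi.2) (ih (N - i) (by omega))
      rw [← pow_add] at hmem
      exact Ideal.pow_le_pow_right (by omega) hmem

/-- High powers of an ideal with `ℓ` generators lie in the bracket powers of its ordinary
powers. -/
theorem Ideal.span_range_pow_le_frobPow {R : Type*} [CommRing R] {ℓ : ℕ} (g : Fin ℓ → R)
    {n q N : ℕ} (hq : 0 < q) (hN : n * q + ℓ * (q - 1) < N + q) :
    Ideal.span (Set.range g) ^ N ≤ (Ideal.span (Set.range g) ^ n).frobPow q := by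
  rw [Ideal.span, Submodule.span_pow, Submodule.span_le]
  intro x hx
  obtain ⟨f, rfl⟩ := Set.mem_pow.mp hx
  choose c hc using fun i => (f i).2
  set d : Fin ℓ → ℕ := fun j => (Finset.univ.filter fun i => c i = j).card with hd
  have hprod : (List.ofFn fun i => (f i : R)).prod = ∏ j, g j ^ d j := by
    rw [List.prod_ofFn, ← Finset.prod_fiberwise Finset.univ c]
    refine Finset.prod_congr rfl fun j _ => ?_
    rw [hd, ← Finset.prod_const]
    refine Finset.prod_congr rfl fun i hi => ?_
    rw [← hc i, (Finset.mem_filter.mp hi).2]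
  have hcard : ∑ j, d j = N := by
    simpa using (Finset.card_eq_sum_card_fiberwise (f := c) (s := Finset.univ)
      (t := Finset.univ) (fun _ _ => Finset.mem_univ _)).symm
  have hquot : n ≤ ∑ j, d j / q := by
    have hle : N ≤ q * ∑ j, d j / q + ℓ * (q - 1) := by
      calc N = ∑ j, (q * (d j / q) + d j % q) := by simp_rw [Nat.div_add_mod, hcard]
        _ ≤ ∑ j, (q * (d j / q) + (q - 1)) :=
          Finset.sum_le_sum fun j _ =>
            Nat.add_le_add_left (Nat.le_sub_one_of_lt (Nat.mod_lt _ hq)) _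
        _ = q * ∑ j, d j / q + ℓ * (q - 1) := by
          simp [Finset.sum_add_distrib, Finset.mul_sum]
    by_contra! hlt
    have := Nat.mul_le_mul_left q (Nat.succ_le_of_lt hlt)
    rw [Nat.mul_succ, Nat.mul_comm q n] at this
    omega
  have hmem : ∏ j, g j ^ (d j / q) ∈ Ideal.span (Set.range g) ^ n := by
    refine Ideal.pow_le_pow_right hquot ?_
    rw [← Finset.prod_pow_eq_pow_sum]
    exact Ideal.prod_mem_prod fun j _ =>
      Ideal.pow_mem_pow (Ideal.subset_span (Set.mem_range_self j)) _
  have hsplit : ∏ j, g j ^ d j = (∏ j, g j ^ (d j % q)) * (∏ j, g j ^ (d j / q)) ^ q := by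
    rw [← Finset.prod_pow, ← Finset.prod_mul_distrib]
    refine Finset.prod_congr rfl fun j _ => ?_
    rw [← pow_mul, ← pow_add, Nat.mul_comm, Nat.mod_add_div]
  rw [hprod, hsplit]
  exact Ideal.mul_mem_left _ _ (Ideal.subset_span (Set.mem_image_of_mem _ hmem))

/-- Let `R` be a noetherian ring of prime characteristic `p` in which every element of `R°`
(the complement of the union of the minimal primes) is a non-zero-divisor.  If `I` can be
generated by `ℓ` elements, then `(I ^ (ℓ + n))⁻ ⊆ (I ^ n)^F` for every `n ≥ 1`. -/
theorem intClosure_pow_le_frobClosure {R : Type*} [CommRing R] [IsNoetherianRing R]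
    (p : ℕ) (hp : p.Prime) [CharP R p]
    (hR : ∀ c : R, (∀ P ∈ minimalPrimes R, c ∉ P) → c ∈ nonZeroDivisors R)
    (I : Ideal R) (ℓ : ℕ) (g : Fin ℓ → R) (hg : I = Ideal.span (Set.range g)) :
    ∀ n : ℕ, 1 ≤ n → (I ^ (ℓ + n)).intClosure ⊆ (I ^ n).frobClosure p := by
  rintro n - r ⟨m, hm, a, ha, h⟩
  obtain ⟨e, he⟩ := pow_unbounded_of_one_lt ((ℓ + n) * m + m) hp.one_lt
  refine ⟨e, ?_⟩
  generalize p ^ e = q at he ⊢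
  have hmem := Ideal.pow_mem_pow_of_integral_equation ha h q
  rw [← pow_mul] at hmem
  subst hg
  refine Ideal.span_range_pow_le_frobPow g (by omega) ?_ hmem
  obtain ⟨t, rfl⟩ := Nat.exists_eq_add_of_le (show m ≤ q by omega)
  obtain ⟨s, hs⟩ := Nat.exists_eq_add_of_lt he
  have h1 : m + t + 1 - m = t + 1 := by omega
  have h2 : ℓ * (m + t - 1) ≤ ℓ * (m + t) := Nat.mul_le_mul_left _ (Nat.sub_le _ _)
  rw [h1]
  nlinarith
end

section
/- Let R be a noetherian F-pure ring of prime characteristic p. If I is an ideal of R that can be generated by ℓ elements, then for every integer n ≥ 1 the integral closure of I^{ℓ+n} is contained in I^n. -/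
universe u

/-- A copy of `R` regarded as a module over itself via the Frobenius endomorphism. -/
def FrobeniusTwist (R : Type u) (_p : ℕ) : Type u := R

instance {R : Type u} [CommRing R] {p : ℕ} : AddCommGroup (FrobeniusTwist R p) :=
  inferInstanceAs (AddCommGroup R)

noncomputable instance {R : Type u} [CommRing R] {p : ℕ} [Fact p.Prime] [CharP R p] :
    Module R (FrobeniusTwist R p) :=
  Module.compHom R (frobenius R p)

/-- The Frobenius `r ↦ r ^ p`, viewed as an `R`-linear map from `R` to the Frobenius twist
of `R`. -/
noncomputable def frobeniusLinearMap (R : Type u) [CommRing R] (p : ℕ) [Fact p.Prime]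
    [CharP R p] : R →ₗ[R] FrobeniusTwist R p :=
  Module.compHom.toLinearMap (frobenius R p)

/-- A ring `R` of prime characteristic `p` is *F-pure* if the Frobenius endomorphism
`φ : r ↦ r ^ p` is pure, i.e. `φ ⊗ id_M` is injective for every `R`-module `M`. -/
def IsFPure (R : Type u) [CommRing R] (p : ℕ) [Fact p.Prime] [CharP R p] : Prop :=
  ∀ (M : Type u) [AddCommGroup M] [Module R M],
    Function.Injective (LinearMap.rTensor M (frobeniusLinearMap R p))

open TensorProduct in
/-- In an F-pure ring every ideal is contracted from its extension along the Frobenius. -/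
theorem IsFPure.mem_of_frobenius_mem_map {R : Type u} [CommRing R] {p : ℕ} [Fact p.Prime]
    [CharP R p] (hFP : IsFPure R p) {K : Ideal R} {z : R}
    (hz : frobenius R p z ∈ K.map (frobenius R p)) : z ∈ K := by
  have smul_mk_one (r : R) : r • Ideal.Quotient.mk K 1 = Ideal.Quotient.mk K r := by
    rw [← Ideal.Quotient.mk_eq_mk, ← Submodule.Quotient.mk_smul, smul_eq_mul, mul_one,
      Ideal.Quotient.mk_eq_mk]
  let ι : R →+ FrobeniusTwist R p := AddMonoidHom.id R
  have ι_mul (r k : R) : ι (frobenius R p k * r) = k • ι r := rfl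
  let τ : R →+ FrobeniusTwist R p ⊗[R] (R ⧸ K) :=
    ((TensorProduct.mk R _ (R ⧸ K)).flip (Ideal.Quotient.mk K 1)).toAddMonoidHom.comp ι
  have τ_mul (r k : R) : τ (frobenius R p k * r) = ι r ⊗ₜ[R] Ideal.Quotient.mk K k := by
    rw [← smul_mk_one k, ← TensorProduct.smul_tmul, ← ι_mul]
    rfl
  have τ_eq_zero : ∀ y ∈ K.map (frobenius R p), τ y = 0 := by
    intro y hy
    induction hy using Submodule.closure_induction with
    | zero => exact map_zero τ
    | add x y _ _ hx hy => rw [map_add, hx, hy, add_zero]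
    | smul_mem r y hy =>
      obtain ⟨k, hk, rfl⟩ := hy
      rw [smul_eq_mul, mul_comm]
      exact (τ_mul r k).trans
        (by rw [Ideal.Quotient.eq_zero_iff_mem.mpr hk, TensorProduct.tmul_zero])
  have h0 : LinearMap.rTensor (R ⧸ K) (frobeniusLinearMap R p)
      (1 ⊗ₜ Ideal.Quotient.mk K z) = 0 := by
    rw [← τ_eq_zero _ hz, ← mul_one (frobenius R p z), τ_mul, LinearMap.rTensor_tmul]
    congr 1
    exact map_one (frobenius R p)
  have h1 := hFP (R ⧸ K) (h0.trans (map_zero _).symm)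
  have h2 := congrArg (TensorProduct.lid R (R ⧸ K)) h1
  rw [TensorProduct.lid_tmul, one_smul, map_zero] at h2
  exact Ideal.Quotient.eq_zero_iff_mem.mp h2

theorem IsFPure.mem_of_iterateFrobenius_mem_map {R : Type u} [CommRing R] {p : ℕ}
    [Fact p.Prime] [CharP R p] (hFP : IsFPure R p) {K : Ideal R} {z : R} (e : ℕ)
    (hz : iterateFrobenius R p e z ∈ K.map (iterateFrobenius R p e)) : z ∈ K := by
  induction e generalizing K z with
  | zero => simpa [iterateFrobenius_zero, Ideal.map_id] using hz
  | succ e ih =>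
    rw [add_comm, iterateFrobenius_add, iterateFrobenius_one, ← Ideal.map_map] at hz
    exact ih (hFP.mem_of_frobenius_mem_map hz)

/-- Powers of an element integral over `J` lie in powers of `J`, up to a fixed shift. -/
theorem Ideal.pow_mem_pow_of_mem_intClosure {R : Type*} [CommRing R] {J : Ideal R} {z : R}
    (hz : z ∈ J.intClosure) : ∃ m : ℕ, ∀ N, z ^ N ∈ J ^ (N - m) := by
  obtain ⟨m, -, a, ha, h⟩ := hz
  refine ⟨m, fun N => ?_⟩
  induction N using Nat.strong_induction_on with
  | _ N ih =>
    rcases le_or_gt N m with hN | hN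
    · simp [Nat.sub_eq_zero_of_le hN]
    have hzN : z ^ N = -∑ i ∈ Finset.Icc 1 m, a i * z ^ (N - i) := by
      have hs : ∑ i ∈ Finset.Icc 1 m, a i * z ^ (N - i) =
          (∑ i ∈ Finset.Icc 1 m, a i * z ^ (m - i)) * z ^ (N - m) := by
        rw [Finset.sum_mul]
        refine Finset.sum_congr rfl fun i hi => ?_
        have hi := Finset.mem_Icc.mp hi
        rw [mul_assoc, ← pow_add]
        congr 2
        omega
      rw [hs, eq_neg_of_add_eq_zero_right h, neg_mul, neg_neg, ← pow_add]
      congr 1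
      omega
    rw [hzN]
    refine neg_mem (Ideal.sum_mem _ fun i hi => ?_)
    have hi := Finset.mem_Icc.mp hi
    refine Ideal.pow_le_pow_right (show N - m ≤ i + (N - i - m) by omega) ?_
    rw [pow_add]
    exact Ideal.mul_mem_mul (ha i hi.1 hi.2) (ih _ (by omega))

/-- A large power of an ideal generated by `ℓ` elements lies in a Frobenius power of `I ^ n`. -/
theorem Ideal.span_range_pow_le_map_iterateFrobenius {R : Type*} [CommRing R] (p : ℕ)
    [Fact p.Prime] [CharP R p] {ℓ : ℕ} (g : Fin ℓ → R) (e n D : ℕ)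
    (hD : (ℓ + n) * p ^ e < D + p ^ e) :
    Ideal.span (Set.range g) ^ D ≤
      (Ideal.span (Set.range g) ^ n).map (iterateFrobenius R p e) := by
  intro x hx
  obtain ⟨f, hf, rfl⟩ := (Ideal.mem_span_pow_iff_exists_isHomogeneous ..).mp hx
  rw [MvPolynomial.eval_eq']
  refine Ideal.sum_mem _ fun d hd => Ideal.mul_mem_left _ _ ?_
  have hdeg : ∑ i, d i = D := by
    rw [← hf (MvPolynomial.mem_support_iff.mp hd), Finsupp.weight_apply,
      Finsupp.sum_fintype _ _ (by simp)]
    simp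
  have hq : 0 < p ^ e := pow_pos (Fact.out : p.Prime).pos e
  have hn : n ≤ ∑ i, d i / p ^ e := by
    have hle : ∑ i, d i ≤ p ^ e * ∑ i, d i / p ^ e + ℓ * p ^ e := by
      calc ∑ i, d i ≤ ∑ i, (p ^ e * (d i / p ^ e) + p ^ e) :=
            Finset.sum_le_sum fun i _ => by
              have := Nat.div_add_mod (d i) (p ^ e)
              have := Nat.mod_lt (d i) hq
              omega
        _ = _ := by simp [Finset.sum_add_distrib, Finset.mul_sum]
    by_contra! hlt
    have := Nat.mul_le_mul_left (p ^ e) hlt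
    rw [hdeg] at hle
    nlinarith
  have hsplit : ∏ i, g i ^ d i =
      (∏ i, g i ^ (d i % p ^ e)) * iterateFrobenius R p e (∏ i, g i ^ (d i / p ^ e)) := by
    rw [iterateFrobenius_def, ← Finset.prod_pow, ← Finset.prod_mul_distrib]
    refine Finset.prod_congr rfl fun i _ => ?_
    rw [← pow_mul, ← pow_add, mul_comm _ (p ^ e), Nat.mod_add_div]
  rw [hsplit]
  refine Ideal.mul_mem_left _ _ (Ideal.mem_map_of_mem _ (Ideal.pow_le_pow_right hn ?_))
  rw [← Finset.prod_pow_eq_pow_sum]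
  exact Ideal.prod_mem_prod fun i _ =>
    Ideal.pow_mem_pow (Ideal.subset_span (Set.mem_range_self i)) _

/-- Let `R` be a noetherian F-pure ring of prime characteristic `p` and `I` an ideal generated
by `ℓ` elements.  Then `(I ^ (ℓ + n))⁻ ⊆ I ^ n` for every `n ≥ 1`. -/
theorem intClosure_pow_le_of_isFPure {R : Type u} [CommRing R] [IsNoetherianRing R]
    (p : ℕ) [Fact p.Prime] [CharP R p] (hFP : IsFPure R p)
    (I : Ideal R) (ℓ : ℕ) (g : Fin ℓ → R) (hg : I = Ideal.span (Set.range g)) :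
    ∀ n : ℕ, 1 ≤ n → (I ^ (ℓ + n)).intClosure ⊆ ↑(I ^ n) := by
  intro n hn z hz
  obtain ⟨m, hm⟩ := Ideal.pow_mem_pow_of_mem_intClosure hz
  obtain ⟨e, he⟩ : ∃ e, (ℓ + n) * m < p ^ e :=
    pow_unbounded_of_one_lt _ (Fact.out : p.Prime).one_lt
  refine hFP.mem_of_iterateFrobenius_mem_map e ?_
  have hz' := hm (p ^ e)
  rw [← pow_mul] at hz'
  subst hg
  rw [iterateFrobenius_def]
  refine Ideal.span_range_pow_le_map_iterateFrobenius p g e n _ ?_ hz'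
  rw [Nat.mul_sub]
  omega
end

section
/- Let (R, m) be a noetherian F-pure local ring of prime characteristic p with infinite residue field. Then for every ideal I of R and every integer n ≥ 1, the integral closure of I^{ℓ(I)+n} is contained in I^n, where ℓ(I) is the analytic spread of I. -/
universe u

/-- The fiber cone of an ideal `I` in a local ring `(R, m)`: the quotient of the Rees algebra
`R[It] = ⊕ I^j t^j` by the ideal generated by `m`; its `j`-th graded piece is `I^j / m I^j`. -/
noncomputable def fiberCone (R : Type*) [CommRing R] [IsLocalRing R] (I : Ideal R) :=
  reesAlgebra I ⧸ (Ideal.map (algebraMap R (reesAlgebra I)) (IsLocalRing.maximalIdeal R))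

noncomputable instance (R : Type*) [CommRing R] [IsLocalRing R] (I : Ideal R) :
    CommRing (fiberCone R I) :=
  inferInstanceAs (CommRing (reesAlgebra I ⧸
    (Ideal.map (algebraMap R (reesAlgebra I)) (IsLocalRing.maximalIdeal R))))

/-- The analytic spread `ℓ(I)` of an ideal `I` of a local ring `(R, m)`: the Krull dimension of
the fiber cone `⊕_{j ≥ 0} I^j / m I^j` of `I`. -/
noncomputable def analyticSpread (R : Type*) [CommRing R] [IsLocalRing R] (I : Ideal R) :
    WithBot (WithTop ℕ) :=
  ringKrullDim (fiberCone R I)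

theorem Ideal.pow_mem_pow_sub_of_mem_intClosure {R : Type*} [CommRing R] {K : Ideal R} {r : R}
    (hr : r ∈ K.intClosure) : ∃ m : ℕ, ∀ N : ℕ, r ^ N ∈ K ^ (N - m) := by
  obtain ⟨m, -, a, ha, h⟩ := hr
  refine ⟨m, fun N ↦ ?_⟩
  induction N using Nat.strong_induction_on with
  | _ N ih =>
    rcases lt_or_ge N m with hN | hN
    · simp [Nat.sub_eq_zero_of_le hN.le]
    · have key : r ^ N = -∑ i ∈ Finset.Icc 1 m, a i * r ^ (N - i) := by
        have e : r ^ N = r ^ (N - m) * r ^ m := by rw [← pow_add, Nat.sub_add_cancel hN]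
        rw [e, eq_neg_of_add_eq_zero_left h, mul_neg, Finset.mul_sum]
        refine congrArg _ (Finset.sum_congr rfl fun i hi ↦ ?_)
        rw [Finset.mem_Icc] at hi
        rw [mul_left_comm, ← pow_add]
        congr 2
        omega
      rw [key]
      refine neg_mem (Ideal.sum_mem _ fun i hi ↦ ?_)
      rw [Finset.mem_Icc] at hi
      have h1 := Ideal.mul_mem_mul (ha i hi.1 hi.2) (ih (N - i) (by omega))
      rw [← pow_add] at h1
      exact Ideal.pow_le_pow_right (by omega) h1

theorem Ideal.span_image_pow_le_pow_of_forall_pow_mem {R ι : Type*} [CommRing R] (f : ι → R)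
    (K : Ideal R) {q : ℕ} (hq : 0 < q) (s : Finset ι) (hf : ∀ i ∈ s, f i ^ q ∈ K) (N n : ℕ)
    (h : n * q + s.card * (q - 1) < N + q) :
    Ideal.span (f '' s) ^ N ≤ K ^ n := by
  classical
  induction s using Finset.induction_on generalizing N n with
  | empty =>
    rcases Nat.eq_zero_or_pos n with rfl | hn
    · simp
    · have : N ≠ 0 := by
        rintro rfl
        have := Nat.le_mul_of_pos_left q hn
        simp at h
        omega
      rw [Finset.coe_empty, Set.image_empty, Ideal.span_empty, ← Ideal.zero_eq_bot, zero_pow this]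
      exact bot_le
  | insert i s his ih =>
    rw [Finset.coe_insert, Set.image_insert_eq, Ideal.span_insert, ← Ideal.add_eq_sup, add_pow]
    refine Finset.sum_induction _ (· ≤ K ^ n) (fun _ _ ↦ sup_le) bot_le fun b hb ↦
      Ideal.mul_le_left.trans ?_
    rw [Finset.mem_range] at hb
    rw [Finset.card_insert_of_notMem his] at h
    have hfb : Ideal.span {f i} ^ b ≤ K ^ (b / q) := by
      rw [Ideal.span_singleton_pow, Ideal.span_singleton_le_iff_mem]
      have := Ideal.pow_mem_pow (hf i (Finset.mem_insert_self i s)) (b / q)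
      rw [← pow_mul] at this
      exact Ideal.mem_of_dvd _ (pow_dvd_pow _ (Nat.mul_div_le b q)) this
    rcases le_total n (b / q) with hn | hn
    · exact Ideal.mul_le_left.trans (hfb.trans (Ideal.pow_le_pow_right hn))
    · have hs := ih (fun j hj ↦ hf j (Finset.mem_insert_of_mem hj)) (N - b) (n - b / q) (by
        have h1 := Nat.div_add_mod b q
        have h2 := Nat.mod_lt b hq
        obtain ⟨c, rfl⟩ := Nat.exists_eq_add_of_le hn
        rw [Nat.add_sub_cancel_left]
        rw [mul_comm] at h1
        have : (s.card + 1) * (q - 1) = s.card * (q - 1) + (q - 1) := by ring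
        rw [this, add_mul] at h
        omega)
      calc Ideal.span {f i} ^ b * Ideal.span (f '' s) ^ (N - b)
          ≤ K ^ (b / q) * K ^ (n - b / q) := Ideal.mul_mono hfb hs
        _ = K ^ n := by rw [← pow_add]; congr 1; omega

theorem IsFPure.mem_of_pow_mem_map_frobenius {R : Type u} [CommRing R] {p : ℕ} [Fact p.Prime]
    [CharP R p] (h : IsFPure R p) {A : Ideal R} {x : R} (hx : x ^ p ∈ A.map (frobenius R p)) :
    x ∈ A := by
  let toTwist : R →+ FrobeniusTwist R p := AddMonoidHom.id R
  have smul_toTwist (a r : R) : a • toTwist r = toTwist (a ^ p * r) := rfl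
  have map_eq (r : R) : frobeniusLinearMap R p r = toTwist (r ^ p) := rfl
  let one : R ⧸ A := Submodule.Quotient.mk 1
  have smul_one (a : R) : a • one = 0 ↔ a ∈ A := by
    rw [← Submodule.Quotient.mk_smul, Submodule.Quotient.mk_eq_zero, smul_eq_mul, mul_one]
  have key : ∀ y ∈ A.map (frobenius R p), ∀ r : R, toTwist (y * r) ⊗ₜ[R] one = 0 := by
    intro y hy
    induction hy using Submodule.span_induction with
    | mem y hy =>
      obtain ⟨a, ha, rfl⟩ := hy
      intro r
      rw [frobenius_def, ← smul_toTwist, TensorProduct.smul_tmul, (smul_one a).2 ha,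
        TensorProduct.tmul_zero]
    | zero => simp
    | add y z _ _ hy hz =>
      intro r
      rw [add_mul, map_add, TensorProduct.add_tmul, hy, hz, add_zero]
    | smul c y _ hy =>
      intro r
      rw [smul_eq_mul, mul_assoc, mul_left_comm]
      exact hy _
  have hzero : x ⊗ₜ[R] one = 0 := by
    refine h (R ⧸ A) ?_
    rw [map_zero, LinearMap.rTensor_tmul, map_eq, ← mul_one (x ^ p)]
    exact key _ hx 1
  simpa only [TensorProduct.lid_tmul, map_zero, smul_one] using
    congrArg (TensorProduct.lid R (R ⧸ A)) hzero

theorem IsFPure.mem_of_pow_mem_map_iterateFrobenius {R : Type u} [CommRing R] {p : ℕ}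
    [Fact p.Prime] [CharP R p] (h : IsFPure R p) (e : ℕ) {A : Ideal R} {x : R}
    (hx : x ^ p ^ e ∈ A.map (iterateFrobenius R p e)) : x ∈ A := by
  induction e generalizing x A with
  | zero => simpa [iterateFrobenius_zero] using hx
  | succ e ih =>
    refine h.mem_of_pow_mem_map_frobenius (ih ?_)
    rw [Ideal.map_map, ← pow_mul, ← pow_succ']
    convert hx using 2
    ext; simp [iterateFrobenius_def, frobenius_def, ← pow_mul, pow_succ']

theorem Ideal.exists_span_range_minimalPrimes_le_height {k F : Type*} [Field k] [Infinite k]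
    [CommRing F] [IsNoetherianRing F] [Algebra k F] (V : Submodule k F) (n : ℕ) :
    ∃ f : Fin n → F, (∀ i, f i ∈ V) ∧ ∀ P ∈ (Ideal.span (Set.range f)).minimalPrimes,
      ¬ V ≤ P.restrictScalars k → (n : ℕ∞) ≤ P.height := by
  induction n with
  | zero => exact ⟨Fin.elim0, fun i ↦ i.elim0, fun _ _ _ ↦ by simp⟩
  | succ n ih =>
    obtain ⟨f, hfV, hf⟩ := ih
    let S := {Q ∈ (Ideal.span (Set.range f)).minimalPrimes | ¬ V ≤ Q.restrictScalars k}
    have hS : Finite S :=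
      ((Ideal.span (Set.range f)).finite_minimalPrimes_of_isNoetherianRing F).subset
        (Set.sep_subset _ _)
    obtain ⟨x, hx⟩ := Submodule.exists_forall_notMem_of_forall_ne_top
      (fun Q : S ↦ (Q.1.restrictScalars k).comap V.subtype)
      (fun Q h ↦ Q.2.2 (Submodule.comap_subtype_eq_top.1 h))
    refine ⟨Fin.cons x f, Fin.cases x.2 hfV, fun P hP hVP ↦ ?_⟩
    have : P.IsPrime := hP.1.1
    have hle := hP.1.2
    rw [Fin.range_cons, Ideal.span_insert, sup_le_iff, Ideal.span_singleton_le_iff_mem] at hle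
    obtain ⟨Q, hQ, hQP⟩ := Ideal.exists_minimalPrimes_le hle.2
    have : Q.IsPrime := hQ.1.1
    have hVQ : ¬ V ≤ Q.restrictScalars k := fun h ↦ hVP fun v hv ↦ hQP (h hv)
    have hlt : Q < P := lt_of_le_of_ne hQP fun h ↦ hx ⟨Q, hQ, hVQ⟩ (h ▸ hle.1)
    calc ((n + 1 : ℕ) : ℕ∞) = n + 1 := by push_cast; rfl
      _ ≤ Q.height + 1 := by gcongr; exact hf Q hQ hVQ
      _ ≤ P.height := Ideal.height_add_one_le_of_lt_of_isPrime hlt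

open Polynomial in
/-- If `δ : F → F[T]` is a coaction defining an `ℕ`-grading on `F` for which the elements of `V`
are homogeneous of degree one, then a minimal prime over an ideal generated by elements of `V`
which does not contain `V` is strictly contained in a prime ideal. -/
theorem Ideal.exists_lt_of_mem_minimalPrimes_of_coaction {F : Type*} [CommRing F] (V : Set F)
    (δ : F →+* F[X]) (hδ : ∀ x, (δ x).eval 1 = x) (hV : ∀ v ∈ V, δ v = C v * X) {s : Set F}
    (hs : s ⊆ V) {P : Ideal F} (hP : P ∈ (Ideal.span s).minimalPrimes) (hVP : ¬ V ⊆ P) :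
    ∃ Q : Ideal F, Q.IsPrime ∧ P < Q := by
  have hprime : P.IsPrime := hP.1.1
  have : (P.map (C : F →+* F[X])).IsPrime := Ideal.isPrime_map_C_of_isPrime
  have hcore : (P.map (C : F →+* F[X])).comap δ ≤ P := fun x hx ↦ by
    rw [← hδ x, eval_eq_sum]
    exact Ideal.sum_mem _ fun i _ ↦ P.mul_mem_right _ (Ideal.mem_map_C_iff.1 hx i)
  have hle : P ≤ (P.map (C : F →+* F[X])).comap δ := by
    refine hP.2 ⟨inferInstance, Ideal.span_le.2 fun v hv ↦ ?_⟩ hcore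
    rw [SetLike.mem_coe, Ideal.mem_comap, hV v (hs hv)]
    exact Ideal.mul_mem_right _ _ (Ideal.mem_map_of_mem _ (hP.1.2 (Ideal.subset_span hv)))
  refine ⟨P.comap ((constantCoeff).comp δ), inferInstance, lt_of_le_of_ne (fun x hx ↦ ?_) ?_⟩
  · exact Ideal.mem_map_C_iff.1 (hle hx) 0
  · intro h
    refine hVP fun v hv ↦ ?_
    rw [h]
    simp [hV v hv]

open Polynomial in
theorem Ideal.exists_span_range_radical_of_coaction {k F : Type*} [Field k] [Infinite k]
    [CommRing F] [IsNoetherianRing F] [Algebra k F] (V : Submodule k F)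
    (δ : F →+* F[X]) (hδ : ∀ x, (δ x).eval 1 = x) (hV : ∀ v ∈ V, δ v = C v * X) (n : ℕ)
    (hn : ringKrullDim F ≤ n) :
    ∃ f : Fin n → F, (∀ i, f i ∈ V) ∧ (V : Set F) ⊆ (Ideal.span (Set.range f)).radical := by
  obtain ⟨f, hfV, hf⟩ := Ideal.exists_span_range_minimalPrimes_le_height V n
  refine ⟨f, hfV, ?_⟩
  rw [← Ideal.sInf_minimalPrimes]
  intro v hv
  rw [SetLike.mem_coe, Ideal.mem_sInf]
  intro P hP
  by_contra hvP
  have hVP : ¬ (V : Set F) ⊆ P := fun h ↦ hvP (h hv)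
  obtain ⟨Q, hQ, hPQ⟩ := Ideal.exists_lt_of_mem_minimalPrimes_of_coaction (V : Set F) δ hδ hV
    (Set.range_subset_iff.2 hfV) hP hVP
  have : P.IsPrime := hP.1.1
  have h1 : (n : ℕ∞) + 1 ≤ Q.height :=
    (add_le_add_left (hf P hP hVP) 1).trans (Ideal.height_add_one_le_of_lt_of_isPrime hPQ)
  have h2 : (Q.height : WithBot ℕ∞) ≤ (n : ℕ∞) :=
    Ideal.height_le_ringKrullDim_of_isPrime.trans hn
  have h3 := h1.trans (WithBot.coe_le_coe.1 h2)
  norm_cast at h3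
  omega

theorem RingHom.exists_comp_eq_of_forall_exists_apply_eq {A S T : Type*} [Semiring A]
    [Semiring S] [Semiring T] (ι : S →+* T) (hι : Function.Injective ι) (g : A →+* T)
    (hg : ∀ x, ∃ y, ι y = g x) : ∃ h : A →+* S, ∀ x, ι (h x) = g x := by
  let e : S ≃+* ι.rangeS := RingEquiv.ofBijective ι.rangeSRestrict
    ⟨fun a b h ↦ hι (congrArg Subtype.val h), ι.rangeSRestrict_surjective⟩
  exact ⟨(e.symm : ι.rangeS →+* S).comp (g.codRestrict ι.rangeS hg),
    fun x ↦ congrArg Subtype.val (e.apply_symm_apply ⟨g x, hg x⟩)⟩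

open Polynomial in
/-- The coaction `R[It] → R[It][T]`, `a t ^ i ↦ a t ^ i T ^ i`, of the grading of the Rees
algebra. -/
theorem reesAlgebra.exists_coaction {R : Type*} [CommRing R] (I : Ideal R) :
    ∃ δ : reesAlgebra I →+* (reesAlgebra I)[X], (∀ x, (δ x).eval 1 = x) ∧
      (∀ r : R, δ (algebraMap R _ r) = C (algebraMap R _ r)) ∧
      ∀ v : reesAlgebra I, ∀ a, (v : R[X]) = monomial 1 a → δ v = C v * X := by
  let ι : (reesAlgebra I)[X] →+* R[X][X] := mapRingHom (reesAlgebra I).val.toRingHom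
  have hι : Function.Injective ι := map_injective _ Subtype.val_injective
  let δ' : R[X] →+* R[X][X] := eval₂RingHom ((C : R[X] →+* R[X][X]).comp C) (C X * X)
  have hmon (i : ℕ) (a : R) : δ' (monomial i a) = monomial i (monomial i a) := by
    simp only [δ', coe_eval₂RingHom, eval₂_monomial, RingHom.comp_apply, mul_pow, ← C_pow]
    rw [← mul_assoc, ← C_mul, C_mul_X_pow_eq_monomial, C_mul_X_pow_eq_monomial]
  obtain ⟨δ, hδ⟩ := RingHom.exists_comp_eq_of_forall_exists_apply_eq ι hι
    (δ'.comp (reesAlgebra I).val.toRingHom) (fun x ↦ by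
      change δ' (x : R[X]) ∈ ι.rangeS
      rw [(x : R[X]).as_sum_support, map_sum]
      refine sum_mem fun i _ ↦ ⟨monomial i ⟨monomial i ((x : R[X]).coeff i),
        reesAlgebra.monomial_mem.2 (x.2 i)⟩, ?_⟩
      rw [hmon]
      simp [ι])
  replace hδ (x : reesAlgebra I) : ι (δ x) = δ' x := hδ x
  refine ⟨δ, fun x ↦ Subtype.ext ?_, fun r ↦ hι ?_, fun v a hv ↦ hι ?_⟩
  · have h1 : (((δ x).eval 1 : reesAlgebra I) : R[X]) = (ι (δ x)).eval 1 := by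
      simp only [ι, coe_mapRingHom]
      rw [eval_map, eval₂_at_one]
      rfl
    have h2 : (evalRingHom (1 : R[X])).comp δ' = RingHom.id _ := by
      ext <;> simp [δ']
    rw [h1, hδ]
    exact congrArg (· (x : R[X])) (congrArg DFunLike.coe h2)
  · rw [hδ]
    have := hmon 0 r
    simp only [monomial_zero_left] at this
    simpa [ι] using this
  · rw [hδ, hv, hmon, ← C_mul_X_eq_monomial]
    simp [ι, hv]

open Polynomial in
theorem reesAlgebra.coeff_mem_of_mem_span_sup_map {R : Type*} [CommRing R] {I B M : Ideal R}
    {s : Set (reesAlgebra I)} (hs : ∀ v ∈ s, ∃ b ∈ B, (v : R[X]) = monomial 1 b)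
    {x : reesAlgebra I} (hx : x ∈ Ideal.span s ⊔ M.map (algebraMap R (reesAlgebra I))) (n : ℕ) :
    (x : R[X]).coeff (n + 1) ∈ B * I ^ n ⊔ M * I ^ (n + 1) := by
  rw [Ideal.map, ← Ideal.span_union] at hx
  suffices ∀ y : reesAlgebra I, ((y * x : reesAlgebra I) : R[X]).coeff (n + 1) ∈
      B * I ^ n ⊔ M * I ^ (n + 1) by simpa using this 1
  induction hx using Submodule.span_induction with
  | mem x hx =>
    intro y
    rcases hx with hx | ⟨r, hr, rfl⟩
    · obtain ⟨b, hb, h⟩ := hs x hx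
      rw [MulMemClass.coe_mul, h, ← C_mul_X_eq_monomial, ← mul_assoc, coeff_mul_X, coeff_mul_C,
        mul_comm _ b]
      exact Ideal.mem_sup_left (Ideal.mul_mem_mul hb (y.2 n))
    · have : ((y * algebraMap R (reesAlgebra I) r : reesAlgebra I) : R[X]) = (y : R[X]) * C r :=
        rfl
      rw [this, coeff_mul_C, mul_comm _ r]
      exact Ideal.mem_sup_right (Ideal.mul_mem_mul hr (y.2 _))
  | zero => simp
  | add x z _ _ hx hz =>
    intro y
    rw [mul_add, AddMemClass.coe_add, coeff_add]
    exact add_mem (hx y) (hz y)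
  | smul a x _ hx =>
    intro y
    rw [smul_eq_mul, ← mul_assoc]
    exact hx _

open Polynomial in
/-- If the quotient `F` of the Rees algebra of `I` by the extension of `M` has dimension at most
`ℓ`, then `I` has a reduction generated by `ℓ` elements. -/
theorem Ideal.exists_pow_add_le_span_range_pow_of_ringKrullDim_le {R k F : Type*} [CommRing R]
    [IsNoetherianRing R] [Field k] [Infinite k] [CommRing F] [IsNoetherianRing F]
    (I M : Ideal R) (hM : M ≤ (⊥ : Ideal R).jacobson) (ρ : R →+* k) (hρ : Function.Surjective ρ)
    (hkerρ : RingHom.ker ρ = M)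
    (π : reesAlgebra I →+* F) (hπ : Function.Surjective π)
    (hker : RingHom.ker π = M.map (algebraMap R (reesAlgebra I)))
    (ℓ : ℕ) (hℓ : ringKrullDim F ≤ ℓ) :
    ∃ b : Fin ℓ → R, (∀ i, b i ∈ I) ∧
      ∃ s : ℕ, ∀ t : ℕ, I ^ (t + s) ≤ Ideal.span (Set.range b) ^ t := by
  have hMπ : M ≤ RingHom.ker (π.comp (algebraMap R (reesAlgebra I))) := by
    rw [← RingHom.comap_ker, hker]
    exact Ideal.le_comap_map
  let φ : k →+* F := RingHom.liftOfSurjective ρ hρ ⟨_, hkerρ.trans_le hMπ⟩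
  have hcomp (r : R) : φ (ρ r) = π (algebraMap R _ r) :=
    RingHom.liftOfRightInverse_comp_apply _ _ _ _ r
  let _ : Algebra k F := φ.toAlgebra
  let V : Submodule k F :=
    { carrier := {x | ∃ v : reesAlgebra I, ∃ a, (v : R[X]) = monomial 1 a ∧ π v = x}
      zero_mem' := ⟨0, 0, by simp, map_zero π⟩
      add_mem' := by
        rintro _ _ ⟨v, a, hv, rfl⟩ ⟨w, b, hw, rfl⟩
        exact ⟨v + w, a + b, by simp [hv, hw], map_add π v w⟩
      smul_mem' := by
        rintro c _ ⟨v, a, hv, rfl⟩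
        obtain ⟨r, rfl⟩ := hρ c
        refine ⟨algebraMap R _ r * v, r * a, ?_, ?_⟩
        · change C r * (v : R[X]) = _
          rw [hv, C_mul_monomial]
        · rw [Algebra.smul_def, RingHom.algebraMap_toAlgebra, map_mul, hcomp] }
  obtain ⟨δ, hδ1, hδC, hδV⟩ := reesAlgebra.exists_coaction I
  obtain ⟨δF, hδF⟩ : ∃ δF : F →+* F[X], ∀ x, δF (π x) = (δ x).map π := by
    refine ⟨RingHom.liftOfSurjective π hπ ⟨(mapRingHom π).comp δ, ?_⟩, fun x ↦
      RingHom.liftOfRightInverse_comp_apply _ _ _ _ x⟩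
    rw [hker, Ideal.map_le_iff_le_comap]
    intro r hr
    have : π (algebraMap R _ r) = 0 := hMπ hr
    rw [Ideal.mem_comap, RingHom.mem_ker, RingHom.comp_apply, hδC, coe_mapRingHom, map_C, this,
      C_0]
  obtain ⟨f, hfV, hf⟩ := Ideal.exists_span_range_radical_of_coaction V δF
    (fun x ↦ by
      obtain ⟨x, rfl⟩ := hπ x
      rw [hδF, eval_map, eval₂_at_one, hδ1])
    (by
      rintro _ ⟨v, a, hv, rfl⟩
      rw [hδF, hδV v a hv]
      simp) ℓ hℓ
  choose v b hvb hvf using hfV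
  have hbI (i) : b i ∈ I := by
    have := (v i).2 1
    rwa [hvb, coeff_monomial_same, pow_one] at this
  obtain ⟨n, hn⟩ := Ideal.exists_pow_le_of_le_radical_of_fg (Ideal.span_le.2 hf)
    (IsNoetherian.noetherian (Ideal.span (V : Set F)))
  have hmem (s : ℕ) (c : R) (hc : c ∈ I ^ s) :
      π ⟨monomial s c, reesAlgebra.monomial_mem.2 hc⟩ ∈ Ideal.span (V : Set F) ^ s := by
    induction hc using Submodule.pow_induction_on_left' with
    | algebraMap r => simp
    | add x y i hx hy h1 h2 =>
      convert add_mem h1 h2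
      rw [← map_add]
      congr 1
      ext1
      simp
    | mem_mul m hm i x hx h =>
      rw [pow_succ']
      convert Ideal.mul_mem_mul (Ideal.subset_span (s := (V : Set F))
        ⟨⟨monomial 1 m, reesAlgebra.monomial_mem.2 (by simpa using hm)⟩, m, rfl, rfl⟩) h
      rw [← map_mul]
      congr 1
      ext1
      simp [monomial_mul_monomial, add_comm]
  have hmap : Ideal.span (Set.range f) = (Ideal.span (Set.range v)).map π := by
    rw [Ideal.map_span, ← Set.range_comp]
    congr 2
    exact funext fun i ↦ (hvf i).symm
  let B := Ideal.span (Set.range b)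
  have hstep : I ^ (n + 1) ≤ B * I ^ n := by
    refine Submodule.le_of_le_smul_of_le_jacobson_bot (I := M) (IsNoetherian.noetherian _)
      hM fun c hc ↦ ?_
    have h1 := hn (Ideal.pow_le_pow_right n.le_succ (hmem (n + 1) c hc))
    rw [hmap, ← Ideal.mem_comap, Ideal.comap_map_of_surjective' π hπ, hker] at h1
    have h2 := reesAlgebra.coeff_mem_of_mem_span_sup_map (B := B) (by
      rintro _ ⟨i, rfl⟩
      exact ⟨b i, Ideal.subset_span ⟨i, rfl⟩, hvb i⟩) h1 n
    simpa using h2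
  refine ⟨b, hbI, n, fun t ↦ ?_⟩
  suffices I ^ (t + n) ≤ B ^ t * I ^ n from this.trans Ideal.mul_le_left
  induction t with
  | zero => simp
  | succ t ih =>
    calc I ^ (t + 1 + n) = I * I ^ (t + n) := by ring
      _ ≤ I * (B ^ t * I ^ n) := Ideal.mul_mono_right ih
      _ = B ^ t * I ^ (n + 1) := by ring
      _ ≤ B ^ t * (B * I ^ n) := Ideal.mul_mono_right hstep
      _ = B ^ (t + 1) * I ^ n := by ring

/-- An ideal of a noetherian local ring with infinite residue field has a reduction generated by
`analyticSpread R I` elements. -/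
theorem Ideal.exists_pow_add_le_span_range_pow_of_analyticSpread_le {R : Type*} [CommRing R]
    [IsNoetherianRing R] [IsLocalRing R] [Infinite (IsLocalRing.ResidueField R)] (I : Ideal R)
    (ℓ : ℕ) (hℓ : analyticSpread R I ≤ (ℓ : WithBot (WithTop ℕ))) :
    ∃ b : Fin ℓ → R, (∀ i, b i ∈ I) ∧
      ∃ s : ℕ, ∀ t : ℕ, I ^ (t + s) ≤ Ideal.span (Set.range b) ^ t := by
  let J := (IsLocalRing.maximalIdeal R).map (algebraMap R (reesAlgebra I))
  have hdim : ringKrullDim (reesAlgebra I ⧸ J) ≤ ℓ := hℓ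
  refine Ideal.exists_pow_add_le_span_range_pow_of_ringKrullDim_le (F := reesAlgebra I ⧸ J)
    I (IsLocalRing.maximalIdeal R) (IsLocalRing.maximalIdeal_le_jacobson _)
    (IsLocalRing.residue R) IsLocalRing.residue_surjective IsLocalRing.ker_residue
    (Ideal.Quotient.mk J) ?_ ?_ ℓ hdim
  · exact Ideal.Quotient.mk_surjective
  · exact Ideal.mk_ker

/-- Let `(R, m)` be a noetherian F-pure local ring of prime characteristic `p` with infinite
residue field.  Then for every ideal `I` with analytic spread `ℓ(I)` and every `n ≥ 1`,
the integral closure of `I ^ (ℓ(I) + n)` is contained in `I ^ n`. -/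
theorem intClosure_pow_analyticSpread_le_of_isFPure {R : Type u} [CommRing R]
    [IsNoetherianRing R] [IsLocalRing R] [Infinite (IsLocalRing.ResidueField R)]
    (p : ℕ) [Fact p.Prime] [CharP R p] (hFP : IsFPure R p)
    (I : Ideal R) (ℓ : ℕ) (hℓ : analyticSpread R I = (ℓ : WithBot (WithTop ℕ))) :
    ∀ n : ℕ, 1 ≤ n → (I ^ (ℓ + n)).intClosure ⊆ ↑(I ^ n) := by
  intro n hn x hx
  have hp : 1 < p := (Fact.out : p.Prime).one_lt
  obtain ⟨b, hbI, s, hs⟩ := I.exists_pow_add_le_span_range_pow_of_analyticSpread_le ℓ hℓ.le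
  obtain ⟨m, hm⟩ := Ideal.pow_mem_pow_sub_of_mem_intClosure hx
  obtain ⟨e, he⟩ : ∃ e, m + (ℓ + n) * m + s < p ^ e := ⟨_, Nat.lt_pow_self hp⟩
  refine hFP.mem_of_pow_mem_map_iterateFrobenius e ?_
  generalize hq : p ^ e = q at he
  have hN : n * q + ℓ * (q - 1) + s < (ℓ + n) * (q - m) + q := by
    obtain ⟨d, rfl⟩ := Nat.exists_eq_add_of_le (show m ≤ q by omega)
    have h1 : ℓ * (m + d - 1) ≤ ℓ * (m + d) := Nat.mul_le_mul_left _ (Nat.sub_le _ _)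
    rw [Nat.add_sub_cancel_left]
    nlinarith
  have hqn : q ≤ n * q := Nat.le_mul_of_pos_left q hn
  have h1 := hm q
  rw [← pow_mul] at h1
  have h2 : x ^ q ∈ Ideal.span (Set.range b) ^ ((ℓ + n) * (q - m) - s) :=
    hs _ (Ideal.pow_le_pow_right (by omega) h1)
  let K := (Ideal.span (Set.range b)).map (iterateFrobenius R p e)
  have h3 := Ideal.span_image_pow_le_pow_of_forall_pow_mem b K (q := q) (by omega) Finset.univ
    (fun i _ ↦ by
      rw [← hq, ← iterateFrobenius_def]
      exact Ideal.mem_map_of_mem _ (Ideal.subset_span ⟨i, rfl⟩))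
    ((ℓ + n) * (q - m) - s) n (by rw [Finset.card_fin]; omega)
  rw [Finset.coe_univ, Set.image_univ] at h3
  have h4 := h3 h2
  rw [← Ideal.map_pow] at h4
  exact Ideal.map_mono (Ideal.pow_right_mono (Ideal.span_le.2 (Set.range_subset_iff.2 hbI)) n) h4
end

section
/- Let p be a prime with p ≡ 1 (mod 3), let K be an algebraic closure of the field with p elements, let R = K[[x, y, z]]/(x^3 + y^3 + z^3), and let I = (x, y) ⊆ R. Then the image of z^2 in R lies in the integral closure of I^2 (indeed (z^2)^3 ∈ (I^2)^3), but z^2 ∉ I; in particular the integral closure of I^2 is not contained in I. -/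
open MvPowerSeries in
/-- The ideal `(x^3 + y^3 + z^3)` in the power series ring `K[[x, y, z]]` over the algebraic
closure `K` of `𝔽_p`. -/
noncomputable def cubicIdeal (p : ℕ) [Fact p.Prime] :
    Ideal (MvPowerSeries (Fin 3) (AlgebraicClosure (ZMod p))) :=
  Ideal.span {(X 0 : MvPowerSeries (Fin 3) (AlgebraicClosure (ZMod p))) ^ 3 + X 1 ^ 3 + X 2 ^ 3}

/-- The ring `R = K[[x, y, z]] / (x^3 + y^3 + z^3)`, where `K` is an algebraic closure of
`𝔽_p`. -/
noncomputable def CubicRing (p : ℕ) [Fact p.Prime] :=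
  MvPowerSeries (Fin 3) (AlgebraicClosure (ZMod p)) ⧸ cubicIdeal p

noncomputable instance (p : ℕ) [Fact p.Prime] : CommRing (CubicRing p) :=
  inferInstanceAs (CommRing (MvPowerSeries (Fin 3) (AlgebraicClosure (ZMod p)) ⧸ cubicIdeal p))

/-- In a ring where `x ^ 3 + y ^ 3 + z ^ 3 = 0`, the cube of `z ^ 2` lies in `((x, y) ^ 2) ^ 3`. -/
theorem sq_pow_three_mem_of_sum_cubes_eq_zero {A : Type*} [CommRing A] {x y z : A}
    (h : x ^ 3 + y ^ 3 + z ^ 3 = 0) :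
    (z ^ 2) ^ 3 ∈ ((Ideal.span {x, y} : Ideal A) ^ 2) ^ 3 := by
  have hx : x ∈ (Ideal.span {x, y} : Ideal A) := Ideal.subset_span (by simp)
  have hy : y ∈ (Ideal.span {x, y} : Ideal A) := Ideal.subset_span (by simp)
  have hz : z ^ 3 ∈ (Ideal.span {x, y} : Ideal A) ^ 3 := by
    rw [show z ^ 3 = -(x ^ 3 + y ^ 3) by linear_combination h]
    exact neg_mem (add_mem (Ideal.pow_mem_pow hx 3) (Ideal.pow_mem_pow hy 3))
  rw [pow_right_comm z, pow_right_comm (Ideal.span {x, y})]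
  exact Ideal.pow_mem_pow hz 2

/-- An element whose `m`-th power lies in `J ^ m` is integral over `J`. -/
theorem Ideal.mem_intClosure_of_pow_mem {A : Type*} [CommRing A] {J : Ideal A} {r : A} {m : ℕ}
    (hm : 0 < m) (h : r ^ m ∈ J ^ m) : r ∈ J.intClosure := by
  refine ⟨m, hm, fun i => if i = m then -r ^ m else 0, fun i _ _ => ?_, ?_⟩
  · dsimp only
    split_ifs with hi
    · subst hi
      exact neg_mem h
    · exact zero_mem _
  · rw [Finset.sum_eq_single_of_mem m (Finset.mem_Icc.2 ⟨hm, le_rfl⟩)]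
    · simp
    · intro i _ hi
      simp [hi]

/-- In `k[[x, y, z]]`, the element `z ^ 2` is not in the ideal `(x, y, x ^ 3 + y ^ 3 + z ^ 3)`. -/
theorem MvPowerSeries.X_two_sq_ne {k : Type*} [CommRing k] [Nontrivial k]
    (a b c : MvPowerSeries (Fin 3) k) :
    (X 2 : MvPowerSeries (Fin 3) k) ^ 2 ≠
      a * X 0 + b * X 1 + c * (X 0 ^ 3 + X 1 ^ 3 + X 2 ^ 3) := by
  intro h
  rw [show a * X 0 + b * X 1 + c * (X 0 ^ 3 + X 1 ^ 3 + X 2 ^ 3) =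
      X 0 * (a + c * X 0 ^ 2) + X 1 * (b + c * X 1 ^ 2) + X 2 ^ 3 * c by ring] at h
  have h := congrArg (coeff (Finsupp.single 2 2)) h
  rw [map_add, map_add, X_dvd_iff.1 (Dvd.intro _ rfl) _ (by simp),
    X_dvd_iff.1 (Dvd.intro _ rfl) _ (by simp),
    X_pow_dvd_iff.1 (Dvd.intro _ rfl) _ (by simp), coeff_X_pow] at h
  simp at h

open MvPowerSeries in
/-- In `R = K[[x, y, z]]/(x^3 + y^3 + z^3)` with `K = 𝔽_p⁻`, `p ≡ 1 (mod 3)`, and `I = (x, y)`: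
the image of `z ^ 2` lies in the integral closure of `I ^ 2` (indeed `(z^2)^3 ∈ (I^2)^3`), but
`z ^ 2 ∉ I`; in particular the integral closure of `I ^ 2` is not contained in `I`. -/
theorem cubicRing_intClosure_sq_not_le (p : ℕ) [Fact p.Prime] (hp3 : p % 3 = 1) :
    let q : MvPowerSeries (Fin 3) (AlgebraicClosure (ZMod p)) → CubicRing p :=
      Ideal.Quotient.mk (cubicIdeal p)
    let I : Ideal (CubicRing p) := Ideal.span {q (X 0), q (X 1)}
    (q (X 2) ^ 2) ^ 3 ∈ (I ^ 2) ^ 3 ∧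
    q (X 2) ^ 2 ∈ (I ^ 2).intClosure ∧
    q (X 2) ^ 2 ∉ I ∧
    ¬ (I ^ 2).intClosure ⊆ ↑I := by
  intro q I
  have h0 : q (X 0) ^ 3 + q (X 1) ^ 3 + q (X 2) ^ 3 = 0 :=
    Ideal.Quotient.eq_zero_iff_mem.2 (Ideal.subset_span rfl)
  have h1 : (q (X 2) ^ 2) ^ 3 ∈ (I ^ 2) ^ 3 := sq_pow_three_mem_of_sum_cubes_eq_zero h0
  have h2 : q (X 2) ^ 2 ∈ (I ^ 2).intClosure :=
    Ideal.mem_intClosure_of_pow_mem (by norm_num) h1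
  have h3 : q (X 2) ^ 2 ∉ I := by
    intro h
    obtain ⟨a, b, hab⟩ := Ideal.mem_span_pair.1 h
    obtain ⟨a, rfl⟩ := Ideal.Quotient.mk_surjective (I := cubicIdeal p) a
    obtain ⟨b, rfl⟩ := Ideal.Quotient.mk_surjective (I := cubicIdeal p) b
    have hmem : X 2 ^ 2 - (a * X 0 + b * X 1) ∈ cubicIdeal p := Ideal.Quotient.eq.1 hab.symm
    obtain ⟨c, hc⟩ := Ideal.mem_span_singleton'.1 hmem
    exact X_two_sq_ne a b c (by rw [hc]; ring)
  exact ⟨h1, h2, h3, fun h => h3 (h h2)⟩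
end

section
/- Let R be a commutative ring of prime characteristic p and let I be an ideal generated by ℓ elements. Let n ≥ 1 and m ≥ 0 be integers, and let q = p^e be a power of p with q + ℓ > m. Then I^{(ℓ+n)q − m} ⊆ (I^n)^{[q]}. -/
/-- A power of the ideal generated by `g` is generated by the monomials in `g` of that degree. -/
theorem Ideal.span_range_pow_le {R ι : Type*} [CommRing R] [Fintype ι] (g : ι → R) (k : ℕ) :
    Ideal.span (Set.range g) ^ k ≤
      Ideal.span {x | ∃ a : ι → ℕ, ∑ i, a i = k ∧ ∏ i, g i ^ a i = x} := by
  classical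
  induction k with
  | zero =>
    rw [pow_zero, Ideal.one_eq_top, top_le_iff, Ideal.eq_top_iff_one]
    exact Ideal.subset_span ⟨0, by simp, by simp⟩
  | succ k ih =>
    rw [pow_succ]
    refine (Ideal.mul_mono_left ih).trans ?_
    rw [Ideal.span_mul_span', Ideal.span_le]
    rintro _ ⟨_, ⟨a, ha, rfl⟩, _, ⟨j, rfl⟩, rfl⟩
    refine Ideal.subset_span ⟨a + Pi.single j 1, ?_, ?_⟩
    · simp [Finset.sum_add_distrib, ha]
    · simp only [Pi.add_apply, pow_add, Finset.prod_mul_distrib]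
      simp [Pi.single_apply, pow_ite]

/-- A monomial in elements of `I` lies in the bracket power `(I ^ n) ^ [q]` if it is divisible by
the `q`-th power of a monomial of degree at least `n`. -/
theorem Ideal.prod_pow_mem_frobPow {R ι : Type*} [CommRing R] [Fintype ι] {I : Ideal R}
    {g : ι → R} (hg : ∀ i, g i ∈ I) {a : ι → ℕ} {n q : ℕ} (h : n ≤ ∑ i, a i / q) :
    ∏ i, g i ^ a i ∈ (I ^ n).frobPow q := by
  have hmem : ∏ i, g i ^ (a i / q) ∈ I ^ n := by
    refine Ideal.pow_le_pow_right h ?_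
    rw [← Finset.prod_pow_eq_pow_sum]
    exact Ideal.prod_mem_prod fun i _ => Ideal.pow_mem_pow (hg i) _
  have hsplit : ∏ i, g i ^ a i = (∏ i, g i ^ (a i % q)) * (∏ i, g i ^ (a i / q)) ^ q := by
    rw [← Finset.prod_pow, ← Finset.prod_mul_distrib]
    refine Finset.prod_congr rfl fun i _ => ?_
    rw [← pow_mul, ← pow_add, Nat.mod_add_div']
  rw [hsplit]
  exact Ideal.mul_mem_left _ _ (Ideal.subset_span ⟨_, hmem, rfl⟩)

/-- Exponents of large total size have quotients by `q` of large total size. -/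
theorem Nat.sum_le_mul_sum_div_add {ι : Type*} [Fintype ι] (a : ι → ℕ) {q : ℕ} (hq : 0 < q) :
    ∑ i, a i + Fintype.card ι ≤ q * ∑ i, a i / q + Fintype.card ι * q := by
  have h : ∑ i, (a i + 1) ≤ ∑ i, (q * (a i / q) + q) := by
    refine Finset.sum_le_sum fun i _ => ?_
    have := Nat.div_add_mod (a i) q
    have := Nat.mod_lt (a i) hq
    omega
  simpa [Finset.sum_add_distrib, Finset.mul_sum] using h

/-- Let `R` be a commutative ring of prime characteristic `p` and `I` an ideal generated by `ℓ`
elements.  If `n ≥ 1`, `m ≥ 0`, and `q = p ^ e` satisfies `q + ℓ > m`, then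
`I ^ ((ℓ + n) * q - m) ⊆ (I ^ n) ^ [q]`. -/
theorem pow_le_frobPow {R : Type*} [CommRing R] (p : ℕ) (hp : p.Prime) [CharP R p]
    (I : Ideal R) (ℓ : ℕ) (g : Fin ℓ → R) (hg : I = Ideal.span (Set.range g))
    (n m e : ℕ) (hn : 1 ≤ n) (q : ℕ) (hq : q = p ^ e) (hqm : m < q + ℓ) :
    I ^ ((ℓ + n) * q - m) ≤ (I ^ n).frobPow q := by
  have hq0 : 0 < q := hq ▸ pow_pos hp.pos e
  subst hg
  refine (Ideal.span_range_pow_le g _).trans (Ideal.span_le.2 ?_)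
  rintro _ ⟨a, ha, rfl⟩
  refine Ideal.prod_pow_mem_frobPow (fun i => Ideal.subset_span (Set.mem_range_self i)) ?_
  by_contra! hlt
  have hsum := Nat.sum_le_mul_sum_div_add a hq0
  rw [ha, Fintype.card_fin] at hsum
  have hquot : q * (∑ i, a i / q + 1) ≤ q * n := Nat.mul_le_mul_left q hlt
  rw [mul_add, mul_one] at hquot
  rw [add_mul, mul_comm n q] at hsum
  omega
end

section
/- Let (R, m) be a noetherian local ring of prime characteristic p and let g_1, …, g_t be a regular sequence in R. Set I = (g_1, …, g_t). If I is Frobenius closed (I^F = I), then I^n is Frobenius closed ((I^n)^F = I^n) for every integer n ≥ 1. -/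
section

open MvPolynomial RingTheory.Sequence
open scoped Pointwise

theorem isWeaklyRegular_of_exact {R : Type*} [CommRing R] (rs : List R) {M₁ M₂ M₃ : Type*}
    [AddCommGroup M₁] [AddCommGroup M₂] [AddCommGroup M₃] [Module R M₁] [Module R M₂] [Module R M₃]
    {f : M₁ →ₗ[R] M₂} {g : M₂ →ₗ[R] M₃} (hf : Function.Injective f) (hfg : Function.Exact f g)
    (hg : Function.Surjective g) (h₁ : IsWeaklyRegular M₁ rs) (h₃ : IsWeaklyRegular M₃ rs) :
    IsWeaklyRegular M₂ rs := by
  induction rs generalizing M₁ M₂ M₃ with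
  | nil => exact .nil R M₂
  | cons r rs ih =>
    rw [isWeaklyRegular_cons_iff] at h₁ h₃ ⊢
    refine ⟨isSMulRegular_of_range_eq_ker hf hfg.linearMap_ker_eq.symm h₁.1 h₃.1,
      ih ?_ (QuotSMulTop.map_exact r hfg hg) (QuotSMulTop.map_surjective r hg) h₁.2 h₃.2⟩
    have h0 : Function.Exact (0 : M₁ →ₗ[R] M₁) f := by
      rw [LinearMap.exact_iff, LinearMap.ker_eq_bot.mpr hf, LinearMap.range_zero]
    have := QuotSMulTop.map_first_exact_on_four_term_exact_of_isSMulRegular_last h0 hfg h₃.1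
    rw [map_zero, LinearMap.exact_iff, LinearMap.range_zero] at this
    exact LinearMap.ker_eq_bot.mp this

theorem isWeaklyRegular_quotSMulTop_pow {R M : Type*} [CommRing R] [AddCommGroup M] [Module R M]
    {r : R} (hr : IsSMulRegular M r) {rs : List R} (h : IsWeaklyRegular (QuotSMulTop r M) rs)
    (n : ℕ) : IsWeaklyRegular (QuotSMulTop (r ^ n) M) rs := by
  induction n with
  | zero =>
    have : Subsingleton (QuotSMulTop (r ^ 0) M) := by
      rw [QuotSMulTop, Submodule.Quotient.subsingleton_iff, pow_zero, one_smul]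
    exact ⟨fun i hi => Function.injective_of_subsingleton _⟩
  | succ n ih =>
    have hle : r ^ n • (⊤ : Submodule R M) ≤
        (r ^ (n + 1) • (⊤ : Submodule R M)).comap (LinearMap.lsmul R M r) := by
      rintro _ ⟨x, -, rfl⟩
      exact ⟨x, trivial, by simp [pow_succ', mul_smul, smul_comm r]⟩
    have hle' : r ^ (n + 1) • (⊤ : Submodule R M) ≤
        (r • (⊤ : Submodule R M)).comap LinearMap.id := by
      rintro _ ⟨x, -, rfl⟩
      exact ⟨r ^ n • x, trivial, by simp [pow_succ', mul_smul, smul_comm r]⟩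
    refine isWeaklyRegular_of_exact rs (f := Submodule.mapQ _ _ _ hle)
      (g := Submodule.mapQ _ _ _ hle') ?_ ?_ ?_ ih h
    · rw [injective_iff_map_eq_zero]
      intro x
      obtain ⟨x, rfl⟩ := Submodule.Quotient.mk_surjective _ x
      rw [Submodule.mapQ_apply, Submodule.Quotient.mk_eq_zero, Submodule.Quotient.mk_eq_zero]
      rintro ⟨y, -, hy⟩
      refine ⟨y, trivial, hr ?_⟩
      simpa [pow_succ', mul_smul] using hy
    · intro x
      obtain ⟨x, rfl⟩ := Submodule.Quotient.mk_surjective _ x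
      rw [Submodule.mapQ_apply, Submodule.Quotient.mk_eq_zero]
      constructor
      · rintro ⟨y, -, hy⟩
        exact ⟨Submodule.Quotient.mk y, by rw [Submodule.mapQ_apply]; exact congrArg _ hy⟩
      · rintro ⟨y, hy⟩
        obtain ⟨y, rfl⟩ := Submodule.Quotient.mk_surjective _ y
        rw [Submodule.mapQ_apply, Submodule.Quotient.eq] at hy
        obtain ⟨z, -, hz⟩ := hy
        refine ⟨y - r ^ n • z, trivial, ?_⟩
        have hz' : r ^ (n + 1) • z = r • y - x := hz
        change r • (y - r ^ n • z) = x
        rw [smul_sub, ← mul_smul, ← pow_succ', hz', sub_sub_cancel]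
    · intro x
      obtain ⟨x, rfl⟩ := Submodule.Quotient.mk_surjective _ x
      exact ⟨Submodule.Quotient.mk x, rfl⟩

theorem isWeaklyRegular_map_pow {R M : Type*} [CommRing R] [AddCommGroup M] [Module R M]
    {rs : List R} (h : IsWeaklyRegular M rs) (n : ℕ) : IsWeaklyRegular M (rs.map (· ^ n)) := by
  induction rs generalizing M with
  | nil => exact .nil R M
  | cons r rs ih =>
    rw [isWeaklyRegular_cons_iff] at h
    exact .cons (h.1.pow n) (isWeaklyRegular_quotSMulTop_pow h.1 (ih h.2) n)

theorem mul_mem_span_of_isWeaklyRegular {R : Type*} [CommRing R] {rs : List R}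
    (h : IsWeaklyRegular R rs) {k : ℕ} (hk : k < rs.length) {y : R}
    (hy : rs.getD k 0 * y ∈ Ideal.span ((rs.getD · 0) '' Set.Iio k)) :
    y ∈ Ideal.span ((rs.getD · 0) '' Set.Iio k) := by
  have hset : (rs.getD · 0) '' Set.Iio k = {r | r ∈ rs.take k} := by
    ext r
    simp only [Set.mem_image, Set.mem_Iio, Set.mem_ofPred_eq, List.mem_take_iff_getElem]
    constructor
    · rintro ⟨i, hi, rfl⟩
      exact ⟨i, by omega, (List.getD_eq_getElem _ _ (hi.trans hk)).symm⟩
    · rintro ⟨i, hi, rfl⟩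
      exact ⟨i, by omega, by rw [List.getD_eq_getElem]⟩
  have := h.regular_mod_prev k hk
  rw [isSMulRegular_quotient_iff_mem_of_smul_mem] at this
  rw [hset] at hy ⊢
  rw [List.getD_eq_getElem _ _ hk] at hy
  simpa [Ideal.ofList] using this y (by simpa [Ideal.ofList] using hy)

theorem exists_isHomogeneous_of_mem_mul_span_pow {R : Type*} [CommRing R] {σ : Type*} (g : σ → R)
    (s : Set σ) (K : Ideal R) {n : ℕ} {x : R} (hx : x ∈ K * Ideal.span (g '' s) ^ n) :
    ∃ F : MvPolynomial σ R, F.IsHomogeneous n ∧ F ∈ supported R s ∧ eval g F = x ∧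
      ∀ m, coeff m F ∈ K := by
  induction hx using Submodule.mul_induction_on' with
  | mem_mul_mem a ha b hb =>
    rw [Set.image_eq_range, Ideal.mem_span_pow_iff_exists_isHomogeneous] at hb
    obtain ⟨G, hG, rfl⟩ := hb
    refine ⟨C a * rename (↑) G, (hG.rename_isHomogeneous).C_mul a, ?_, ?_, fun m => ?_⟩
    · refine mul_mem ((supported R s).algebraMap_mem a) ?_
      rw [supported_eq_range_rename]
      exact ⟨G, rfl⟩
    · simp [eval_rename, Function.comp_def]
    · rw [coeff_C_mul]
      exact K.mul_mem_right _ ha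
  | add a _ b _ iha ihb =>
    obtain ⟨F, h1, h2, h3, h4⟩ := iha
    obtain ⟨G, h1', h2', h3', h4'⟩ := ihb
    exact ⟨F + G, h1.add h1', add_mem h2 h2', by simp [h3, h3'],
      fun m => by rw [coeff_add]; exact add_mem (h4 m) (h4' m)⟩

theorem eval_mem_of_isHomogeneous {R : Type*} [CommRing R] {σ : Type*} (g : σ → R)
    {s : Set σ} {K : Ideal R} {n : ℕ} {F : MvPolynomial σ R} (hF : F.IsHomogeneous n)
    (hs : F ∈ supported R s) (hK : ∀ m, coeff m F ∈ K) :
    eval g F ∈ K * Ideal.span (g '' s) ^ n := by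
  rw [eval_eq]
  refine Ideal.sum_mem _ fun m hm => Ideal.mul_mem_mul (hK m) ?_
  have hdeg : ∑ i ∈ m.support, m i = n := by
    exact (Finsupp.degree_eq_weight_one (R := ℕ) ▸ hF (mem_support_iff.mp hm) : m.degree = n)
  rw [← hdeg, ← Finset.prod_pow_eq_pow_sum]
  refine Ideal.prod_mem_prod fun i hi =>
    Ideal.pow_mem_pow (Ideal.subset_span (Set.mem_image_of_mem g ?_)) _
  exact mem_supported.mp hs ((mem_vars_iff_mem_support i).mpr ⟨m, hm, hi⟩)

theorem coeff_mem_of_eval_mem_mul_pow {R : Type*} [CommRing R] {σ : Type*} {g : σ → R} {s : Set σ}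
    (h : ∀ (n : ℕ) (F : MvPolynomial σ R), F.IsHomogeneous n → F ∈ supported R s → eval g F = 0 →
      ∀ m, coeff m F ∈ Ideal.span (g '' s)) {n : ℕ} {F : MvPolynomial σ R}
    (hF : F.IsHomogeneous n) (hs : F ∈ supported R s)
    (h0 : eval g F ∈ Ideal.span (g '' s) ^ (n + 1)) (m : σ →₀ ℕ) :
    coeff m F ∈ Ideal.span (g '' s) := by
  rw [pow_succ'] at h0
  obtain ⟨G, hG, hGs, hGF, hGc⟩ := exists_isHomogeneous_of_mem_mul_span_pow g s _ h0
  have := h n (F - G) (hF.sub hG) (sub_mem hs hGs) (by simp [hGF]) m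
  rw [coeff_sub] at this
  simpa using add_mem this (hGc m)

theorem mem_pow_of_mul_mem_pow {R : Type*} [CommRing R] {σ : Type*} {g : σ → R} {s : Set σ}
    (h : ∀ (n : ℕ) (F : MvPolynomial σ R), F.IsHomogeneous n → F ∈ supported R s → eval g F = 0 →
      ∀ m, coeff m F ∈ Ideal.span (g '' s)) {x : R}
    (hx : ∀ y, x * y ∈ Ideal.span (g '' s) → y ∈ Ideal.span (g '' s)) {n : ℕ} {y : R}
    (hy : x * y ∈ Ideal.span (g '' s) ^ n) : y ∈ Ideal.span (g '' s) ^ n := by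
  induction n with
  | zero => simp
  | succ n ih =>
    have hyn := ih (Ideal.pow_le_pow_right n.le_succ hy)
    rw [← Ideal.top_mul (_ ^ n)] at hyn
    obtain ⟨G, hG, hGs, rfl, -⟩ := exists_isHomogeneous_of_mem_mul_span_pow g s _ hyn
    rw [pow_succ']
    refine eval_mem_of_isHomogeneous g hG hGs fun m => hx _ ?_
    rw [← coeff_C_mul]
    exact coeff_mem_of_eval_mem_mul_pow h (hG.C_mul x)
      (mul_mem ((supported R s).algebraMap_mem x) hGs) (by simpa using hy) m

theorem coeff_mem_span_of_eval_eq_zero {R : Type*} [CommRing R] (g : ℕ → R) (t : ℕ)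
    (hreg : ∀ k < t, ∀ y, g k * y ∈ Ideal.span (g '' Set.Iio k) → y ∈ Ideal.span (g '' Set.Iio k))
    (n : ℕ) (F : MvPolynomial ℕ R) (hF : F.IsHomogeneous n) (hs : F ∈ supported R (Set.Iio t))
    (h0 : eval g F = 0) (m : ℕ →₀ ℕ) : coeff m F ∈ Ideal.span (g '' Set.Iio t) := by
  have hzero : ∀ F : MvPolynomial ℕ R, F.IsHomogeneous 0 → eval g F = 0 → F = 0 := by
    intro F hF h0
    rw [← totalDegree_zero_iff_isHomogeneous, totalDegree_eq_zero_iff_eq_C] at hF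
    rw [hF, eval_C] at h0
    rw [hF, h0, C_0]
  induction t generalizing n F m with
  | zero =>
    obtain ⟨c, rfl⟩ : ∃ c, C c = F := by
      rw [show Set.Iio 0 = (∅ : Set ℕ) by ext; simp, supported_empty, Algebra.mem_bot] at hs
      exact hs
    rw [eval_C] at h0
    simp [h0]
  | succ t ih =>
    have hJ := ih fun k hk => hreg k (hk.trans t.lt_succ_self)
    have hsub : Set.Iio t ⊆ Set.Iio (t + 1) := Set.Iio_subset_Iio t.le_succ
    have hJI : Ideal.span (g '' Set.Iio t) ≤ Ideal.span (g '' Set.Iio (t + 1)) :=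
      Ideal.span_mono (Set.image_mono hsub)
    have hxI : g t ∈ Ideal.span (g '' Set.Iio (t + 1)) :=
      Ideal.subset_span (Set.mem_image_of_mem g t.lt_succ_self)
    induction n generalizing F m with
    | zero => simp [hzero F hF h0]
    | succ n ihn =>
      set G := F.modMonomial (Finsupp.single t 1) with hGdef
      set H := F.divMonomial (Finsupp.single t 1) with hHdef
      have hFGH : X t * H + G = F := divMonomial_add_modMonomial_single F t
      have hGcoeff : ∀ m, coeff m G ≠ 0 → coeff m F ≠ 0 ∧ m t = 0 := by
        intro m hm
        by_cases hle : Finsupp.single t 1 ≤ m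
        · exact absurd (coeff_modMonomial_of_le F hle) hm
        · rw [hGdef, coeff_modMonomial_of_not_le F hle] at hm
          exact ⟨hm, by simpa using hle⟩
      have hvars : ∀ {m i}, coeff m F ≠ 0 → m i ≠ 0 → i < t + 1 := fun {m i} hm hi =>
        mem_supported.mp hs ((mem_vars_iff_mem_support i).mpr
          ⟨m, mem_support_iff.mpr hm, Finsupp.mem_support_iff.mpr hi⟩)
      have hG : G.IsHomogeneous (n + 1) := fun m hm => hF (hGcoeff m hm).1
      have hGs : G ∈ supported R (Set.Iio t) := by
        rw [mem_supported]
        intro i hi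
        obtain ⟨m, hm, hmi⟩ := (mem_vars_iff_mem_support i).mp hi
        obtain ⟨h1, h2⟩ := hGcoeff m (mem_support_iff.mp hm)
        rw [Finsupp.mem_support_iff] at hmi
        have := hvars h1 hmi
        have : i ≠ t := by rintro rfl; exact hmi h2
        simp only [Set.mem_Iio]
        omega
      have hH : H.IsHomogeneous n := by
        intro m hm
        have := hF (show coeff (Finsupp.single t 1 + m) F ≠ 0 from hm)
        rw [map_add, Finsupp.weight_single] at this
        simp only [Pi.one_apply, smul_eq_mul, mul_one] at this
        omega
      have hHs : H ∈ supported R (Set.Iio (t + 1)) := by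
        rw [mem_supported]
        intro i hi
        obtain ⟨m, hm, hmi⟩ := (mem_vars_iff_mem_support i).mp hi
        rw [Finsupp.mem_support_iff] at hmi
        refine hvars (m := Finsupp.single t 1 + m) (show coeff m H ≠ 0 from mem_support_iff.mp hm) ?_
        simp [hmi]
      have heval : g t * eval g H + eval g G = 0 := by
        rw [← h0, ← hFGH]
        simp
      have hHJ : eval g H ∈ Ideal.span (g '' Set.Iio t) ^ (n + 1) := by
        refine mem_pow_of_mul_mem_pow hJ (hreg t t.lt_succ_self) ?_
        rw [eq_neg_of_add_eq_zero_left heval]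
        have := eval_mem_of_isHomogeneous g hG hGs (K := ⊤) fun _ => trivial
        rw [Ideal.top_mul] at this
        exact neg_mem this
      by_cases hle : Finsupp.single t 1 ≤ m
      · obtain ⟨m, rfl⟩ := exists_add_of_le hle
        change coeff m H ∈ _
        have h1 := Ideal.pow_right_mono hJI (n + 1) hHJ
        rw [pow_succ'] at h1
        obtain ⟨H', hH', hHs', hHe', hHc'⟩ := exists_isHomogeneous_of_mem_mul_span_pow g _ _ h1
        have := ihn (H - H') (hH.sub hH') (sub_mem hHs hHs') (by simp [hHe']) m
        rw [coeff_sub] at this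
        exact (sub_add_cancel (coeff m H) _) ▸ add_mem this (hHc' m)
      · rw [← coeff_modMonomial_of_not_le F hle, ← hGdef]
        rw [← Ideal.top_mul (_ ^ (n + 1))] at hHJ
        obtain ⟨h, hh, hhs, hhe, -⟩ := exists_isHomogeneous_of_mem_mul_span_pow g _ _ hHJ
        have := hJ (n + 1) (C (g t) * h + G) ((hh.C_mul _).add hG)
          (add_mem (mul_mem ((supported R _).algebraMap_mem (g t)) hhs) hGs)
          (by simp [hhe, heval]) m
        rw [coeff_add, coeff_C_mul] at this
        simpa using sub_mem (hJI this) (Ideal.mul_mem_right (coeff m h) _ hxI)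

theorem Ideal.frobPow_eq_map {R : Type*} [CommRing R] (p : ℕ) [ExpChar R p] (I : Ideal R) (e : ℕ) :
    I.frobPow (p ^ e) = I.map (iterateFrobenius R p e) := by
  rw [Ideal.frobPow, Ideal.map]
  congr 1

theorem Ideal.subset_frobClosure {R : Type*} [CommRing R] (p : ℕ) (I : Ideal R) :
    (I : Set R) ⊆ I.frobClosure p := fun r hr => ⟨0, Ideal.subset_span ⟨r, hr, rfl⟩⟩

theorem Ideal.frobClosure_mono {R : Type*} [CommRing R] (p : ℕ) {I J : Ideal R} (h : I ≤ J) :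
    I.frobClosure p ⊆ J.frobClosure p :=
  fun _ ⟨e, he⟩ => ⟨e, Ideal.span_mono (Set.image_mono h) he⟩

theorem mem_pow_succ_of_mem_frobClosure {R : Type*} [CommRing R] (p : ℕ) [ExpChar R p] {rs : List R}
    (hreg : IsWeaklyRegular R rs) {I : Ideal R}
    (hI : I = Ideal.span ((rs.getD · 0) '' Set.Iio rs.length)) (hF : I.frobClosure p ⊆ I) {n : ℕ}
    {r : R} (hrn : r ∈ I ^ n) (hr : r ∈ (I ^ (n + 1)).frobClosure p) : r ∈ I ^ (n + 1) := by
  obtain ⟨e, he⟩ := hr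
  set φ := iterateFrobenius R p e
  set q := p ^ e
  set g : ℕ → R := (rs.getD · 0)
  set g' : ℕ → R := ((rs.map (· ^ q)).getD · 0)
  have hgg' : ∀ i, g' i = φ (g i) := by
    have hq : q ≠ 0 := pow_ne_zero _ (expChar_ne_zero R p)
    intro i
    rw [iterateFrobenius_def]
    simp only [g, g', List.getD_eq_getElem?_getD, List.getElem?_map]
    cases rs[i]? with
    | none => exact (zero_pow hq).symm
    | some a => rfl
  have hmap : Ideal.span (g' '' Set.Iio rs.length) = I.map φ := by
    rw [hI, Ideal.map_span, ← Set.image_comp]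
    exact congrArg _ (Set.image_congr fun i _ => hgg' i)
  have hreg' := isWeaklyRegular_map_pow hreg q
  rw [← Ideal.top_mul (I ^ n), hI] at hrn
  obtain ⟨F, hFn, hFs, rfl, -⟩ := exists_isHomogeneous_of_mem_mul_span_pow g _ _ hrn
  rw [pow_succ', hI]
  refine eval_mem_of_isHomogeneous g hFn hFs fun m => ?_
  rw [← hI]
  refine hF ⟨e, ?_⟩
  rw [Ideal.frobPow_eq_map, ← hmap, ← iterateFrobenius_def, ← coeff_map]
  refine coeff_mem_of_eval_mem_mul_pow (fun n F => coeff_mem_span_of_eval_eq_zero g' rs.length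
    (fun k hk y => mul_mem_span_of_isWeaklyRegular hreg' (by simpa using hk)) n F)
    (hFn.map _) ?_ ?_ m
  · rw [mem_supported] at hFs ⊢
    exact (Finset.coe_subset.mpr (vars_map _ _)).trans hFs
  · rw [Ideal.frobPow_eq_map, Ideal.map_pow, ← hmap, ← iterateFrobenius_def] at he
    rwa [show eval g' (map φ F) = φ (eval g F) by
      rw [show g' = φ ∘ g from funext hgg', map_eval]]

end


/-- Let `(R, m)` be a noetherian local ring of prime characteristic `p` and `g₁, …, g_t` a
regular sequence with `I = (g₁, …, g_t)`.  If `I` is Frobenius closed then so is `I ^ n` for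
every `n ≥ 1`. -/
theorem frobClosure_pow_of_regular {R : Type*} [CommRing R] [IsNoetherianRing R]
    [IsLocalRing R] (p : ℕ) (hp : p.Prime) [CharP R p]
    (t : ℕ) (g : Fin t → R) (hreg : RingTheory.Sequence.IsRegular R (List.ofFn g))
    (I : Ideal R) (hI : I = Ideal.span (Set.range g))
    (hF : I.frobClosure p = ↑I) :
    ∀ n : ℕ, 1 ≤ n → (I ^ n).frobClosure p = ↑(I ^ n) := by
  have : ExpChar R p := .prime hp
  have hI' : I = Ideal.span (((List.ofFn g).getD · 0) '' Set.Iio (List.ofFn g).length) := by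
    rw [hI]
    congr 1
    ext r
    constructor
    · rintro ⟨i, rfl⟩
      exact ⟨i, by simp, by simp⟩
    · rintro ⟨i, hi, rfl⟩
      rw [Set.mem_Iio, List.length_ofFn] at hi
      exact ⟨⟨i, hi⟩, by simp [hi]⟩
  suffices h : ∀ n, (I ^ n).frobClosure p ⊆ ↑(I ^ n) from
    fun n _ => (h n).antisymm (Ideal.subset_frobClosure p _)
  intro n
  induction n with
  | zero => simp
  | succ n ih =>
    exact fun r hr => mem_pow_succ_of_mem_frobClosure p hreg.toIsWeaklyRegular hI' hF.subset
      (ih (Ideal.frobClosure_mono p (Ideal.pow_le_pow_right n.le_succ) hr)) hr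
end

section
/- Let (R, m) be a noetherian local ring, let h_1, …, h_t be a regular sequence in R, and set Q = (h_1, …, h_t). Let f ∈ R[Y_1, …, Y_t] be a homogeneous polynomial of degree n. If f(h_1, …, h_t) ∈ Q^{n+1}, then every coefficient of f lies in Q. -/
namespace MvPolynomial

open Ideal

variable {R σ : Type*} [CommRing R]

/-- An element of `J * (a)ⁿ` is the value at `a` of a form of degree `n` with coefficients
in `J`. -/
lemma exists_isHomogeneous_mem_map_C_eval_eq {a : σ → R} {J : Ideal R} {n : ℕ} {y : R}
    (hy : y ∈ J * span (Set.range a) ^ n) :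
    ∃ F : MvPolynomial σ R, F.IsHomogeneous n ∧ F ∈ J.map C ∧ eval a F = y := by
  induction hy using Submodule.mul_induction_on' with
  | mem_mul_mem r hr z hz =>
    obtain ⟨F, hF, rfl⟩ := (mem_span_pow_iff_exists_isHomogeneous a z).1 hz
    exact ⟨C r * F, hF.C_mul r, mul_mem_right _ _ (mem_map_of_mem C hr), by simp⟩
  | add y _ z _ hy hz =>
    obtain ⟨F, hF, hFJ, rfl⟩ := hy
    obtain ⟨G, hG, hGJ, rfl⟩ := hz
    exact ⟨F + G, hF.add hG, add_mem hFJ hGJ, by simp⟩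

/-- The value at `a` of a form of degree `n` with coefficients in `J` lies in `J * (a)ⁿ`. -/
lemma IsHomogeneous.eval_mem_mul_pow {a : σ → R} {J : Ideal R} {n : ℕ} {F : MvPolynomial σ R}
    (hF : F.IsHomogeneous n) (hFJ : F ∈ J.map C) :
    eval a F ∈ J * span (Set.range a) ^ n := by
  rw [F.as_sum, map_sum]
  refine sum_mem fun d hd ↦ ?_
  have hd' : (monomial d (1 : R)).IsHomogeneous n :=
    isHomogeneous_monomial _ <| by
      rw [Finsupp.degree_eq_weight_one]
      exact hF (mem_support_iff.1 hd)
  rw [← mul_one (coeff d F), ← C_mul_monomial, map_mul, eval_C]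
  exact mul_mem_mul (mem_map_C_iff.1 hFJ d)
    ((mem_span_pow_iff_exists_isHomogeneous a _).2 ⟨_, hd', rfl⟩)

lemma rename_mem_map_C {τ : Type*} (f : σ → τ) {J : Ideal R} {F : MvPolynomial σ R}
    (hF : F ∈ J.map C) : rename f F ∈ J.map C := by
  have hle : J.map C ≤ (J.map C).comap (rename f : MvPolynomial σ R →ₐ[R] MvPolynomial τ R) :=
    map_le_iff_le_comap.2 fun r hr ↦ by simpa using mem_map_of_mem C hr
  exact hle hF

/-- A form in `t + 1` variables is the sum of a form in the first `t` variables and a multiple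
of the last variable. -/
lemma IsHomogeneous.exists_eq_rename_castSucc_add_X_mul {t n : ℕ}
    {F : MvPolynomial (Fin (t + 1)) R} (hF : F.IsHomogeneous (n + 1)) :
    ∃ (G : MvPolynomial (Fin t) R) (H : MvPolynomial (Fin (t + 1)) R),
      G.IsHomogeneous (n + 1) ∧ H.IsHomogeneous n ∧
        F = rename Fin.castSucc G + X (Fin.last t) * H := by
  set s : Fin (t + 1) →₀ ℕ := Finsupp.single (Fin.last t) 1 with hs
  have hcoeff : ∀ d, coeff d (F.modMonomial s) ≠ 0 → ¬ s ≤ d ∧ coeff d F ≠ 0 := by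
    intro d hd
    have hsd : ¬ s ≤ d := fun h ↦ hd (coeff_modMonomial_of_le F h)
    exact ⟨hsd, by rwa [coeff_modMonomial_of_not_le F hsd] at hd⟩
  have hvars : (↑(F.modMonomial s).vars : Set (Fin (t + 1))) ⊆ Set.range Fin.castSucc := by
    intro i hi
    obtain ⟨d, hd, hid⟩ := (mem_vars_iff_mem_support i).1 hi
    have hsd := (hcoeff d (mem_support_iff.1 hd)).1
    refine Fin.exists_castSucc_eq.2 ?_
    rintro rfl
    exact hsd (Finsupp.single_le_iff.2 (Nat.one_le_iff_ne_zero.2 (Finsupp.mem_support_iff.1 hid)))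
  obtain ⟨G, hG⟩ := exists_rename_eq_of_vars_subset_range _ _ (Fin.castSucc_injective t) hvars
  refine ⟨G, F.divMonomial s, ?_, ?_, ?_⟩
  · rw [← rename_isHomogeneous_iff (Fin.castSucc_injective t), hG]
    exact fun d hd ↦ hF (hcoeff d hd).2
  · intro d hd
    rw [coeff_divMonomial] at hd
    have := hF hd
    rw [map_add, hs, Finsupp.weight_single] at this
    simp at this
    lia
  · rw [hG, modMonomial_add_divMonomial_single]

/-- If every form in `a` with value in `(a)ⁿ⁺¹` has its coefficients in `(a)`, then a
non-zero-divisor modulo `(a)` is a non-zero-divisor modulo every power of `(a)`. -/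
lemma mem_span_pow_of_mul_mem {a : σ → R} {x : R}
    (ha : ∀ (n : ℕ) (F : MvPolynomial σ R), F.IsHomogeneous n →
      eval a F ∈ span (Set.range a) ^ (n + 1) → F ∈ (span (Set.range a)).map C)
    (hx : ∀ y, x * y ∈ span (Set.range a) → y ∈ span (Set.range a)) (n : ℕ) :
    ∀ y, x * y ∈ span (Set.range a) ^ n → y ∈ span (Set.range a) ^ n := by
  induction n with
  | zero => simp
  | succ n ih =>
    intro y hy
    obtain ⟨G, hG, rfl⟩ :=
      (mem_span_pow_iff_exists_isHomogeneous a y).1 (ih y (pow_le_pow_right n.le_succ hy))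
    have hxG := ha n (C x * G) (hG.C_mul x) (by simpa using hy)
    rw [pow_succ']
    refine hG.eval_mem_mul_pow (mem_map_C_iff.2 fun d ↦ hx _ ?_)
    simpa using mem_map_C_iff.1 hxG d

/-- A weakly regular sequence is quasi-regular. -/
lemma IsHomogeneous.mem_map_C_of_eval_mem_pow {t : ℕ} {a : Fin t → R}
    (ha : RingTheory.Sequence.IsWeaklyRegular R (List.ofFn a)) {n : ℕ}
    {F : MvPolynomial (Fin t) R} (hF : F.IsHomogeneous n)
    (heval : eval a F ∈ span (Set.range a) ^ (n + 1)) :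
    F ∈ (span (Set.range a)).map C := by
  induction t generalizing n with
  | zero =>
    obtain ⟨c, rfl⟩ := C_surjective (Fin 0) F
    rw [eval_C] at heval
    exact mem_map_of_mem C (pow_le_self n.succ_ne_zero heval)
  | succ t iht =>
    rw [List.ofFn_succ_last, RingTheory.Sequence.isWeaklyRegular_append_iff,
      RingTheory.Sequence.isWeaklyRegular_singleton_iff] at ha
    obtain ⟨hb, hx⟩ := ha
    set b : Fin t → R := fun i ↦ a i.castSucc
    set x := a (Fin.last t)
    have hofList : ofList (List.ofFn b) = span (Set.range b) := by
      simp [ofList, List.mem_ofFn, Set.range]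
    have hx' : ∀ y, x * y ∈ span (Set.range b) → y ∈ span (Set.range b) := by
      intro y hy
      rw [isSMulRegular_quotient_iff_mem_of_smul_mem] at hx
      simpa [hofList] using hx y (by simpa [hofList] using hy)
    have hle : span (Set.range b) ≤ span (Set.range a) :=
      span_mono (Set.range_comp_subset_range Fin.castSucc a)
    have hpow := mem_span_pow_of_mul_mem (fun n F hF h ↦ iht hb hF h) hx'
    induction n generalizing F with
    | zero =>
      obtain ⟨c, rfl⟩ : ∃ c, F = C c := ⟨_, totalDegree_eq_zero_iff_eq_C.1 (by
        simpa using hF.totalDegree_le)⟩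
      rw [eval_C, zero_add, pow_one] at heval
      exact mem_map_of_mem C heval
    | succ n ihn =>
      rw [pow_succ'] at heval
      obtain ⟨F', hF', hF'Q, hFF'⟩ := exists_isHomogeneous_mem_map_C_eval_eq heval
      obtain ⟨G, H, hG, hH, hGH⟩ := (hF.sub hF').exists_eq_rename_castSucc_add_X_mul
      have hzero : eval b G + x * eval a H = 0 := by
        have := congrArg (eval a) hGH
        rw [map_sub, hFF', sub_self, map_add, eval_rename, map_mul, eval_X] at this
        exact this.symm
      have hHb : eval a H ∈ span (Set.range b) ^ (n + 1) := by
        refine hpow _ _ ?_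
        rw [eq_neg_of_add_eq_zero_right hzero]
        exact neg_mem ((mem_span_pow_iff_exists_isHomogeneous b _).2 ⟨G, hG, rfl⟩)
      have hHQ := ihn hH (pow_right_mono hle _ hHb)
      obtain ⟨P, hP, hPH⟩ := (mem_span_pow_iff_exists_isHomogeneous b _).1 hHb
      have hGP : G + C x * P ∈ (span (Set.range b)).map C :=
        iht hb (hG.add (hP.C_mul x)) (by simp [hPH, hzero])
      have hren : rename Fin.castSucc (G + C x * P) ∈ (span (Set.range a)).map C :=
        map_mono hle (rename_mem_map_C _ hGP)
      have hxQ : C x ∈ (span (Set.range a)).map (C : R →+* MvPolynomial (Fin (t + 1)) R) :=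
        mem_map_of_mem C (subset_span ⟨_, rfl⟩)
      have key : F = F' + (rename Fin.castSucc (G + C x * P) - C x * rename Fin.castSucc P)
          + X (Fin.last t) * H := by
        rw [map_add, map_mul, rename_C, add_sub_cancel_right, add_assoc, ← hGH,
          add_sub_cancel]
      rw [key]
      exact add_mem (add_mem hF'Q (sub_mem hren (mul_mem_right _ _ hxQ))) (mul_mem_left _ _ hHQ)

end MvPolynomial


/-- Let `(R, m)` be a noetherian local ring, `h₁, …, h_t` a regular sequence generating the
ideal `Q`, and `f ∈ R[Y₁, …, Y_t]` a homogeneous polynomial of degree `n`.  If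
`f (h₁, …, h_t) ∈ Q ^ (n + 1)`, then every coefficient of `f` lies in `Q`. -/
theorem coeff_mem_of_homogeneous_eval_mem_pow {R : Type*} [CommRing R] [IsNoetherianRing R]
    [IsLocalRing R] (t : ℕ) (h : Fin t → R)
    (hreg : RingTheory.Sequence.IsRegular R (List.ofFn h))
    (Q : Ideal R) (hQ : Q = Ideal.span (Set.range h))
    (n : ℕ) (f : MvPolynomial (Fin t) R) (hf : f.IsHomogeneous n)
    (heval : MvPolynomial.eval h f ∈ Q ^ (n + 1)) :
    ∀ d : Fin t →₀ ℕ, MvPolynomial.coeff d f ∈ Q := by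
  subst hQ
  exact MvPolynomial.mem_map_C_iff.1 (hf.mem_map_C_of_eval_mem_pow hreg.toIsWeaklyRegular heval)
end
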